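/- arXiv:2407.20583 — 3 statements merged into one kernel-verified Lean document; each statement's English description precedes it below -/
import Mathlib

section
/- Let q = p^n ≡ 3 (mod 4) be an odd prime power, χ a generator of the character group of F_q^×, and let 1 ≤ r ≤ q-2 be odd. Then ∏_{k=0}^{(q-3)/2} J_q(χ^r, χ^{2k}) = (-1)^{(q-3)/4} · i^n · G_q(χ^r)^{(q-1)/2} / √q, where G_q is the Gauss sum over F_q. -/
open Polynomial in
/-- Applying `X d/dX` repeatedly to `(X - 1) ^ N` lowers the order of vanishing at `1`. -/
lemma Polynomial.exists_iterate_X_mul_derivative_X_sub_one_pow {R : Type*} [CommRing R]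
    (N i : ℕ) (hi : i ≤ N) :
    ∃ h : R[X], (fun f : R[X] ↦ X * derivative f)^[i] ((X - 1) ^ N) = (X - 1) ^ (N - i) * h ∧
      h.eval 1 = (N.descFactorial i : R) := by
  induction i with
  | zero => exact ⟨1, by simp, by simp⟩
  | succ i ih =>
    obtain ⟨h, h₁, h₂⟩ := ih (by lia)
    obtain ⟨k, hk⟩ : ∃ k, N - i = k + 1 := ⟨N - i - 1, by lia⟩
    refine ⟨X * (((k + 1 : ℕ) : R[X]) * h + (X - 1) * derivative h), ?_, ?_⟩
    · rw [Function.iterate_succ_apply', h₁, hk, show N - (i + 1) = k by lia]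
      simp [derivative_mul, derivative_pow]
      ring
    · simp [h₂, Nat.descFactorial_succ, hk]

open Polynomial in
lemma Polynomial.iterate_X_mul_derivative_geom_sum {R : Type*} [CommRing R] (N i : ℕ) :
    (fun f : R[X] ↦ X * derivative f)^[i] (∑ j ∈ Finset.range N, X ^ j) =
      ∑ j ∈ Finset.range N, C ((j : R) ^ i) * X ^ j := by
  induction i with
  | zero => simp
  | succ i ih =>
    rw [Function.iterate_succ_apply', ih]
    simp only [derivative_sum, Finset.mul_sum]
    refine Finset.sum_congr rfl fun j _ ↦ ?_
    rcases j with _ | j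
    · simp only [Nat.cast_zero, pow_zero, mul_one, derivative_C, mul_zero, pow_succ, C_0]
    · rw [derivative_C_mul_X_pow, Nat.add_sub_cancel, mul_left_comm, ← pow_succ', ← pow_succ]

open Polynomial in
lemma Polynomial.exists_X_pow_sub_X_pow {R : Type*} [CommRing R] (a b : ℕ) :
    ∃ h : R[X], X ^ a - X ^ b = (X - 1) * h ∧ h.eval 1 = (a - b : R) :=
  ⟨∑ i ∈ Finset.range a, X ^ i - ∑ i ∈ Finset.range b, X ^ i,
    by rw [mul_sub, mul_geom_sum, mul_geom_sum]; ring, by simp [eval_finsetSum]⟩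

lemma two_pow_mul_prod_odd_mul_factorial (m : ℕ) :
    (∏ k ∈ Finset.range m, 2 * (2 * k + 1)) * m.factorial = (2 * m).factorial := by
  induction m with
  | zero => simp
  | succ m ih =>
    rw [Finset.prod_range_succ, show 2 * (m + 1) = 2 * m + 1 + 1 by ring, Nat.factorial_succ,
      Nat.factorial_succ, Nat.factorial_succ, ← ih]
    ring

open Polynomial in
/-- The congruence modulo `p` which fixes the sign of the quadratic Gauss sum over `ZMod p`. -/
lemma eq_one_of_cyclotomic_dvd {p m : ℕ} [Fact p.Prime] (hm : p = 2 * m + 1) (hm0 : m ≠ 0)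
    {ε : ℤ}
    (h : cyclotomic p ℤ ∣ ∑ j ∈ Finset.range p, C (quadraticChar (ZMod p) j) * X ^ j -
      C ε * ∏ k ∈ Finset.range m, (X ^ (2 * k + 1) - X ^ (p - (2 * k + 1)))) :
    (ε : ZMod p) = 1 := by
  have hp2 : ringChar (ZMod p) ≠ 2 := by rw [ZMod.ringChar_zmod_n]; lia
  have hcyc : cyclotomic p (ZMod p) = (X - 1) ^ (p - 1) := by
    have := cyclotomic_mul_prime_eq_pow_of_not_dvd (ZMod p) (p := p) (n := 1)
      (Fact.out : p.Prime).not_dvd_one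
    simpa using this
  have h' := Polynomial.map_dvd (Int.castRingHom (ZMod p)) h
  rw [map_cyclotomic, hcyc] at h'
  simp only [Polynomial.map_sub, Polynomial.map_sum, Polynomial.map_mul, Polynomial.map_pow,
    Polynomial.map_prod, map_C, map_X] at h'
  simp only [eq_intCast] at h'
  have hsum : ∑ j ∈ Finset.range p, C ((quadraticChar (ZMod p) (j : ZMod p) : ℤ) : ZMod p) * X ^ j =
      (fun f : (ZMod p)[X] ↦ X * derivative f)^[m] ((X - 1) ^ (p - 1)) := by
    have hg : ((X - 1) ^ (p - 1) : (ZMod p)[X]) = ∑ j ∈ Finset.range p, X ^ j := by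
      rw [← hcyc, cyclotomic_prime]
    rw [hg, iterate_X_mul_derivative_geom_sum]
    refine Finset.sum_congr rfl fun j _ ↦ ?_
    rw [quadraticChar_eq_pow_of_char_ne_two' hp2, ZMod.card, show p / 2 = m by lia]
  obtain ⟨h₁, hh₁, he₁⟩ := exists_iterate_X_mul_derivative_X_sub_one_pow (R := ZMod p)
    (p - 1) m (by lia)
  choose g hg hge using fun k : ℕ ↦
    exists_X_pow_sub_X_pow (R := ZMod p) (2 * k + 1) (p - (2 * k + 1))
  rw [hsum, hh₁] at h'
  simp only [hg, Finset.prod_mul_distrib, Finset.prod_const, Finset.card_range] at h'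
  rw [show p - 1 - m = m by lia, show p - 1 = m + m by lia, pow_add, mul_left_comm,
    ← mul_sub, mul_dvd_mul_iff_left (pow_ne_zero _ (by simpa using X_sub_C_ne_zero (1 : ZMod p)))]
    at h'
  have h0 : (h₁ - C (ε : ZMod p) * ∏ k ∈ Finset.range m, g k).eval 1 = 0 := by
    refine dvd_iff_isRoot.1 ((dvd_pow_self _ hm0).trans h')
  have hprod : ∏ k ∈ Finset.range m, (g k).eval 1 =
      ((∏ k ∈ Finset.range m, 2 * (2 * k + 1) : ℕ) : ZMod p) := by
    push_cast
    refine Finset.prod_congr rfl fun k hk ↦ ?_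
    rw [hge, Nat.cast_sub (by have := Finset.mem_range.1 hk; lia)]
    simp
    ring
  rw [eval_sub, eval_mul, eval_C, eval_prod, hprod, he₁, sub_eq_zero] at h0
  have hfac := congrArg (fun x ↦ ((m.factorial : ℕ) : ZMod p) * x) h0
  rw [← Nat.cast_mul, mul_left_comm, ← Nat.cast_mul, mul_comm m.factorial (∏ _ ∈ _, _),
    two_pow_mul_prod_odd_mul_factorial, show p - 1 = 2 * m by lia,
    show m.factorial = (2 * m - m).factorial by congr 1; lia,
    Nat.factorial_mul_descFactorial (by lia)] at hfac
  have hne : (((2 * m).factorial : ℕ) : ZMod p) ≠ 0 := by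
    rw [Ne, ZMod.natCast_eq_zero_iff, (Fact.out : p.Prime).dvd_factorial]
    lia
  exact (mul_eq_right₀ hne).1 hfac.symm

open Complex in
/-- The sign of `∏ 2i sin (2π(2k+1)/p)`. -/
lemma exists_pos_prod_exp_sub_exp {p s : ℕ} (hp : p = 4 * s + 3) :
    ∃ c : ℝ, 0 < c ∧ ∏ k ∈ Finset.range (2 * s + 1),
      (exp (2 * Real.pi * I / p) ^ (2 * k + 1) - exp (2 * Real.pi * I / p) ^ (p - (2 * k + 1))) =
        I * c := by
  have hp0 : (p : ℝ) ≠ 0 := by rw [hp]; positivity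
  have hppos : (0 : ℝ) < p := by rw [hp]; positivity
  have key (k : ℕ) (hk : k < 2 * s + 1) :
      exp (2 * Real.pi * I / p) ^ (2 * k + 1) - exp (2 * Real.pi * I / p) ^ (p - (2 * k + 1)) =
        I * ((2 * Real.sin (Real.pi * (2 * (2 * k + 1) / p)) : ℝ) : ℂ) := by
    have hpc : (p : ℂ) ≠ 0 := by exact_mod_cast hp0
    rw [← exp_nat_mul, ← exp_nat_mul]
    have e₁ : ((2 * k + 1 : ℕ) : ℂ) * (2 * Real.pi * I / p) =
        ((Real.pi * (2 * (2 * k + 1) / p) : ℝ) : ℂ) * I := by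
      push_cast; ring
    have e₂ : ((p - (2 * k + 1) : ℕ) : ℂ) * (2 * Real.pi * I / p) =
        -((Real.pi * (2 * (2 * k + 1) / p) : ℝ) : ℂ) * I + 2 * Real.pi * I := by
      rw [Nat.cast_sub (by lia)]; push_cast; field_simp; ring
    rw [e₁, e₂, exp_periodic]
    generalize Real.pi * (2 * (2 * k + 1) / p) = x
    rw [ofReal_mul, ofReal_sin, ofReal_ofNat, Complex.two_sin]
    linear_combination (exp (x * I) - exp (-x * I)) * I_sq
  rw [Finset.prod_congr rfl fun k hk ↦ key k (Finset.mem_range.1 hk), Finset.prod_mul_distrib,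
    Finset.prod_const, Finset.card_range, pow_succ, pow_mul, I_sq, ← ofReal_prod]
  refine ⟨(-1) ^ s * ∏ k ∈ Finset.range (2 * s + 1),
    2 * Real.sin (Real.pi * (2 * (2 * k + 1) / p)), ?_, by push_cast; ring⟩
  rw [show 2 * s + 1 = (s + 1) + s by ring, Finset.prod_range_add, mul_left_comm]
  refine mul_pos (Finset.prod_pos fun k hk ↦ ?_) ?_
  · have hk' : k < s + 1 := Finset.mem_range.1 hk
    have : (2 * (2 * k + 1) / p : ℝ) < 1 := by
      rw [div_lt_one hppos]; exact_mod_cast (by lia : 2 * (2 * k + 1) < p)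
    have := Real.sin_pos_of_pos_of_lt_pi
      (x := Real.pi * (2 * (2 * k + 1) / p)) (by positivity) (by nlinarith [Real.pi_pos])
    positivity
  · have hs : (-1 : ℝ) ^ s = ∏ _k ∈ Finset.range s, (-1 : ℝ) := by simp
    rw [hs, ← Finset.prod_mul_distrib]
    refine Finset.prod_pos fun k hk ↦ ?_
    have hk' : k < s := Finset.mem_range.1 hk
    have h₁ : (1 : ℝ) < 2 * (2 * (s + 1 + k : ℕ) + 1) / p := by
      rw [one_lt_div hppos]; exact_mod_cast (by lia : p < 2 * (2 * (s + 1 + k) + 1))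
    have h₂ : (2 * (2 * (s + 1 + k : ℕ) + 1) / p : ℝ) < 2 := by
      rw [div_lt_iff₀ hppos]; exact_mod_cast (by lia : 2 * (2 * (s + 1 + k) + 1) < 2 * p)
    have := Real.sin_pos_of_pos_of_lt_pi
      (x := Real.pi * (2 * (2 * (s + 1 + k : ℕ) + 1) / p) - Real.pi)
      (by nlinarith [Real.pi_pos]) (by nlinarith [Real.pi_pos])
    rw [Real.sin_sub_pi] at this
    linarith

lemma prod_range_two_mul {M : Type*} [CommMonoid M] (f : ℕ → M) (m : ℕ) :
    ∏ j ∈ Finset.range (2 * m), f j =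
      ∏ k ∈ Finset.range m, (f (2 * k) * f (2 * k + 1)) := by
  induction m with
  | zero => simp
  | succ m ih =>
    rw [show 2 * (m + 1) = 2 * m + 1 + 1 by ring, Finset.prod_range_succ, Finset.prod_range_succ,
      Finset.prod_range_succ, ih, mul_assoc]

lemma IsPrimitiveRoot.sq_prod_pow_sub_pow {R : Type*} [CommRing R] [IsDomain R] {ζ : R} {p m : ℕ}
    (hζ : IsPrimitiveRoot ζ p) (hm : p = 2 * m + 1) :
    (∏ k ∈ Finset.range m, (ζ ^ (2 * k + 1) - ζ ^ (p - (2 * k + 1)))) ^ 2 = (-1) ^ m * p := by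
  have hall : ∏ j ∈ Finset.range (2 * m), (ζ ^ (j + 1) - ζ ^ (p - (j + 1))) = p := by
    have h₂ : IsPrimitiveRoot (ζ ^ 2) (2 * m + 1) :=
      hm ▸ hζ.pow_of_coprime 2 (by rw [hm]; simp)
    have h₁ : ∏ j ∈ Finset.range (2 * m), ζ ^ (j + 1) = 1 := by
      have hsum : ∑ j ∈ Finset.range (2 * m), (j + 1) = p * m := by
        have := Finset.sum_range_id_mul_two (2 * m + 1)
        rw [Finset.sum_range_succ', add_zero] at this
        rw [hm]
        simp at this
        linarith
      rw [Finset.prod_pow_eq_pow_sum, hsum, pow_mul, hζ.pow_eq_one, one_pow]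
    rw [← mul_one (∏ j ∈ _, _), ← h₁, ← Finset.prod_mul_distrib]
    have := h₂.prod_one_sub_pow_eq_order
    rw [hm, Nat.cast_add_one, ← this, ← one_mul (∏ k ∈ _, (1 - (ζ ^ 2) ^ (k + 1))),
      show (1 : R) = ∏ _j ∈ Finset.range (2 * m), (-1 : R) by simp [pow_mul],
      ← Finset.prod_mul_distrib]
    refine Finset.prod_congr rfl fun j hj ↦ ?_
    have hj' := Finset.mem_range.1 hj
    rw [sub_mul, ← pow_add, ← pow_add, ← hm, Nat.sub_add_cancel (by lia), hζ.pow_eq_one, ← pow_mul]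
    simp [two_mul]
  rw [prod_range_two_mul, Finset.prod_mul_distrib,
    ← Finset.prod_range_reflect (fun k ↦ ζ ^ (2 * k + 1 + 1) - ζ ^ (p - (2 * k + 1 + 1)))] at hall
  have hrefl : ∏ k ∈ Finset.range m, (ζ ^ (2 * (m - 1 - k) + 1 + 1) -
      ζ ^ (p - (2 * (m - 1 - k) + 1 + 1))) =
      (-1) ^ m * ∏ k ∈ Finset.range m, (ζ ^ (2 * k + 1) - ζ ^ (p - (2 * k + 1))) := by
    rw [show (-1 : R) ^ m = ∏ _k ∈ Finset.range m, (-1 : R) by simp, ← Finset.prod_mul_distrib]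
    refine Finset.prod_congr rfl fun k hk ↦ ?_
    have hk' := Finset.mem_range.1 hk
    rw [show 2 * (m - 1 - k) + 1 + 1 = p - (2 * k + 1) by lia,
      show p - (p - (2 * k + 1)) = 2 * k + 1 by lia]
    ring
  rw [hrefl] at hall
  rw [← hall, mul_left_comm, ← mul_assoc ((-1) ^ m), ← mul_pow]
  simp [sq]

open Polynomial in
/-- Gauss's determination of the sign of the quadratic Gauss sum for `p ≡ 3 (mod 4)`. -/
theorem gaussSum_quadraticChar_zmod {p : ℕ} [Fact p.Prime] (hp : p % 4 = 3) :
    gaussSum ((quadraticChar (ZMod p)).ringHomComp (Int.castRingHom ℂ)) ZMod.stdAddChar =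
      Complex.I * (Real.sqrt p : ℝ) := by
  obtain ⟨s, hs⟩ : ∃ s, p = 4 * s + 3 := ⟨p / 4, by lia⟩
  have hp0 : p ≠ 0 := by lia
  have hm : p = 2 * (2 * s + 1) + 1 := by lia
  have hp2 : ringChar (ZMod p) ≠ 2 := by rw [ZMod.ringChar_zmod_n]; lia
  set ζ : ℂ := Complex.exp (2 * Real.pi * Complex.I / p) with hζdef
  have hζ : IsPrimitiveRoot ζ p := Complex.isPrimitiveRoot_exp p hp0
  set g := gaussSum ((quadraticChar (ZMod p)).ringHomComp (Int.castRingHom ℂ)) ZMod.stdAddChar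
    with hg
  have hgsum : g = ∑ j ∈ Finset.range p, ((quadraticChar (ZMod p) (j : ZMod p) : ℤ) : ℂ) * ζ ^ j := by
    rw [hg, gaussSum]
    refine Finset.sum_nbij' (fun x ↦ x.val) (fun j ↦ (j : ZMod p))
      (fun x _ ↦ Finset.mem_range.2 (ZMod.val_lt x)) (by simp) (by simp)
      (fun j hj ↦ ZMod.val_cast_of_lt (Finset.mem_range.1 hj)) fun x _ ↦ ?_
    rw [ZMod.stdAddChar_apply, ZMod.toCircle_apply, hζdef, ← Complex.exp_nat_mul,
      ZMod.natCast_zmod_val]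
    simp only [MulChar.ringHomComp_apply, eq_intCast]
    congr 2
    ring
  set P := ∏ k ∈ Finset.range (2 * s + 1), (ζ ^ (2 * k + 1) - ζ ^ (p - (2 * k + 1))) with hP
  have hPsq : P ^ 2 = -p := by
    rw [hP, hζ.sq_prod_pow_sub_pow hm, pow_succ, pow_mul]
    simp
  have hgsq : g ^ 2 = -p := by
    have hquad := (quadraticChar_isQuadratic (ZMod p)).comp (Int.castRingHom ℂ)
    have hne : (quadraticChar (ZMod p)).ringHomComp (Int.castRingHom ℂ) ≠ 1 :=
      (MulChar.ringHomComp_ne_one_iff (Int.castRingHom ℂ).injective_int).2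
        (quadraticChar_ne_one hp2)
    rw [hg, gaussSum_sq hne hquad (ZMod.isPrimitive_stdAddChar p), ZMod.card]
    have hneg : quadraticChar (ZMod p) (-1) = -1 := by
      rw [quadraticChar_neg_one_iff_not_isSquare, FiniteField.isSquare_neg_one_iff, ZMod.card]
      simpa using hp
    simp [MulChar.ringHomComp_apply, hneg]
  obtain ⟨ε, hε, hgP⟩ : ∃ ε : ℤ, (ε = 1 ∨ ε = -1) ∧ g = ε * P := by
    rcases sq_eq_sq_iff_eq_or_eq_neg.1 (hgsq.trans hPsq.symm) with h | h
    · exact ⟨1, .inl rfl, by simpa using h⟩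
    · exact ⟨-1, .inr rfl, by simpa using h⟩
  have hε1 : (ε : ZMod p) = 1 := by
    refine eq_one_of_cyclotomic_dvd hm (by lia) ?_
    rw [cyclotomic_eq_minpoly hζ (by lia)]
    refine minpoly.isIntegrallyClosed_dvd (hζ.isIntegral (by lia)) ?_
    simp only [map_sub, map_sum, map_mul, map_prod, map_pow, aeval_X, eq_intCast, map_intCast]
    rw [← hgsum, ← hP, hgP, sub_self]
  have hgP' : g = P := by
    rcases hε with rfl | rfl
    · simpa using hgP
    · have h2 : ((2 : ℕ) : ZMod p) = 0 := by push_cast at hε1 ⊢; linear_combination -hε1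
      have := Nat.le_of_dvd two_pos ((ZMod.natCast_eq_zero_iff _ _).1 h2)
      lia
  obtain ⟨c, hc, hPc⟩ := exists_pos_prod_exp_sub_exp hs
  rw [← hζdef, ← hP] at hPc
  have hc2 : c ^ 2 = p := by
    have : ((c ^ 2 : ℝ) : ℂ) = (p : ℝ) := by
      push_cast
      linear_combination (-1 : ℂ) * hPsq + (P + Complex.I * c) * hPc + c ^ 2 * Complex.I_sq
    exact_mod_cast this
  rw [hgP', hPc, ← hc2, Real.sqrt_sq hc.le]

section
variable {F : Type*} [Field F] [Fintype F] [DecidableEq F]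

lemma AddChar.map_sum {A M ι : Type*} [AddCommMonoid A] [CommMonoid M] (ψ : AddChar A M)
    (f : ι → A) (s : Finset ι) : ψ (∑ i ∈ s, f i) = ∏ i ∈ s, ψ (f i) :=
  map_prod ψ.toMonoidHom (fun i ↦ Multiplicative.ofAdd (f i)) s

lemma sum_addChar_sq_eq_gaussSum (hF : ringChar F ≠ 2) {ψ : AddChar F ℂ} (hψ : ψ ≠ 1) :
    ∑ x, ψ (x ^ 2) = gaussSum ((quadraticChar F).ringHomComp (Int.castRingHom ℂ)) ψ := by
  rw [← Finset.sum_fiberwise Finset.univ (fun x : F ↦ x ^ 2)]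
  have h (a : F) : ∑ x ∈ Finset.univ.filter (fun x : F ↦ x ^ 2 = a), ψ (x ^ 2) =
      ((quadraticChar F a : ℤ) : ℂ) * ψ a + ψ a := by
    rw [Finset.sum_congr rfl (g := fun _ ↦ ψ a) (by simp +contextual), Finset.sum_const,
      nsmul_eq_mul, ← add_one_mul]
    have := quadraticChar_card_sqrts hF a
    rw [Set.toFinset_ofPred] at this
    exact_mod_cast congrArg (fun n : ℤ ↦ (n : ℂ) * ψ a) this
  rw [Finset.sum_congr rfl fun a _ ↦ h a, Finset.sum_add_distrib,
    AddChar.sum_eq_zero_of_ne_one hψ, add_zero]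
  rfl

lemma sum_addChar_mul_sq (hF : ringChar F ≠ 2) {ψ : AddChar F ℂ} (hψ : ψ.IsPrimitive) {a : F}
    (ha : a ≠ 0) :
    ∑ x, ψ (a * x ^ 2) = ((quadraticChar F a : ℤ) : ℂ) *
      gaussSum ((quadraticChar F).ringHomComp (Int.castRingHom ℂ)) ψ := by
  have h := gaussSum_mulShift_eq ((quadraticChar F).ringHomComp (Int.castRingHom ℂ)) ψ
    (Units.mk0 a ha)
  rw [((quadraticChar_isQuadratic F).comp _).inv, Units.val_mk0, MulChar.ringHomComp_apply,
    eq_intCast] at h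
  rw [← h, ← sum_addChar_sq_eq_gaussSum hF (hψ ha)]
  simp only [AddChar.mulShift_apply]
end

section
variable {p : ℕ} [Fact p.Prime] {F : Type*} [Field F] [Fintype F] [Algebra (ZMod p) F]

/-- For a finite field of odd degree over its prime field, the discriminant of the trace form is
a square. -/
lemma isSquare_discr_of_odd_finrank {n : ℕ} (hn : n = Module.finrank (ZMod p) F) (hodd : Odd n)
    (v : Module.Basis (Fin n) (ZMod p) F) :
    IsSquare (Algebra.discr (ZMod p) v) := by
  classical
  have := charP_of_injective_algebraMap (algebraMap (ZMod p) F).injective p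
  let M : Matrix (Fin n) (Fin n) F := .of fun i j ↦ v i ^ p ^ (j : ℕ)
  have hfix (x : F) : x ^ p ^ n = x := by
    have := FiniteField.pow_card x
    rwa [Module.card_eq_pow_finrank (K := ZMod p), ZMod.card, ← hn] at this
  have hM : M * M.transpose = (Algebra.traceMatrix (ZMod p) v).map (algebraMap (ZMod p) F) := by
    ext i j
    simp only [Matrix.mul_apply, M, Matrix.transpose_apply, Matrix.of_apply, Matrix.map_apply,
      Algebra.traceMatrix_apply, Algebra.traceForm_apply, FiniteField.algebraMap_trace_eq_sum_pow,
      Nat.card_zmod, ← mul_pow]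
    rw [← hn, Finset.sum_range]
  have hfrob : M.det ^ p = M.det := by
    have h₁ : M.det ^ p = (M.map (frobenius F p)).det := by
      rw [← frobenius_def, RingHom.map_det]; rfl
    have h₂ : M.map (frobenius F p) = M.submatrix id (finRotate n) := by
      ext i j
      obtain ⟨k, hk⟩ : ∃ k, n = k + 1 := ⟨n - 1, by have := hodd.pos; lia⟩
      simp only [M, Matrix.map_apply, Matrix.of_apply, Matrix.submatrix_apply, id, frobenius_def,
        ← pow_mul, ← pow_succ]
      subst hk
      rw [coe_finRotate]
      split_ifs with h
      · rw [h, Fin.val_last, hfix]; simp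
      · rfl
    rw [h₁, h₂, Matrix.det_permute', sign_finRotate, (Nat.Odd.sub_odd hodd odd_one).neg_one_pow]
    simp
  obtain ⟨d, hd⟩ : ∃ d : ZMod p, algebraMap (ZMod p) F d = M.det := by
    obtain ⟨k, hk⟩ := (mem_bot_iff_intCast p F).1
      ((Subfield.mem_bot_iff_pow_eq_self F p).2 hfrob)
    exact ⟨k, by rw [map_intCast, hk]⟩
  refine ⟨d, (algebraMap (ZMod p) F).injective ?_⟩
  rw [Algebra.discr_def, RingHom.map_det, RingHom.mapMatrix_apply, ← hM, Matrix.det_mul,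
    Matrix.det_transpose, map_mul, hd]

lemma sum_stdAddChar_trace_sq (hp : p ≠ 2) (hodd : Odd (Module.finrank (ZMod p) F)) :
    ∑ x : F, ZMod.stdAddChar (Algebra.trace (ZMod p) F (x ^ 2)) =
      gaussSum ((quadraticChar (ZMod p)).ringHomComp (Int.castRingHom ℂ)) ZMod.stdAddChar ^
        Module.finrank (ZMod p) F := by
  have hp2 : ringChar (ZMod p) ≠ 2 := by rwa [ZMod.ringChar_zmod_n]
  have h2 : (2 : ZMod p) ≠ 0 := Ring.two_ne_zero hp2
  have := invertibleOfNonzero h2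
  obtain ⟨v, hv⟩ := LinearMap.BilinForm.exists_orthogonal_basis
    (B := Algebra.traceForm (ZMod p) F) ⟨fun x y ↦ Algebra.traceForm_isSymm (ZMod p) |>.eq x y⟩
  have hdiag : Algebra.traceMatrix (ZMod p) v =
      Matrix.diagonal fun i ↦ Algebra.trace (ZMod p) F (v i * v i) := by
    ext i j
    rcases eq_or_ne i j with rfl | hij
    · simp [Algebra.traceMatrix_apply]
    · rw [Algebra.traceMatrix_apply, Matrix.diagonal_apply_ne _ hij]
      exact hv hij
  have hdiscr : Algebra.discr (ZMod p) v = ∏ i, Algebra.trace (ZMod p) F (v i * v i) := by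
    rw [Algebra.discr_def, hdiag, Matrix.det_diagonal]
  have hdne : Algebra.discr (ZMod p) v ≠ 0 := Algebra.discr_not_zero_of_basis _ _
  have hne (i) : Algebra.trace (ZMod p) F (v i * v i) ≠ 0 :=
    Finset.prod_ne_zero_iff.1 (hdiscr ▸ hdne) i (Finset.mem_univ i)
  have htr (c : Fin (Module.finrank (ZMod p) F) → ZMod p) :
      Algebra.trace (ZMod p) F (v.equivFun.symm c ^ 2) =
        ∑ i, Algebra.trace (ZMod p) F (v i * v i) * c i ^ 2 := by
    rw [v.equivFun_symm_apply, sq, Finset.sum_mul_sum, map_sum]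
    refine Finset.sum_congr rfl fun i _ ↦ ?_
    rw [map_sum, Finset.sum_eq_single i]
    · rw [smul_mul_smul_comm, map_smul, smul_eq_mul, ← sq, mul_comm]
    · intro j _ hij
      rw [smul_mul_smul_comm, map_smul]
      rw [show Algebra.trace (ZMod p) F (v i * v j) = 0 from hv hij.symm, smul_zero]
    · simp
  rw [← v.equivFun.symm.toEquiv.sum_comp]
  simp only [LinearEquiv.coe_toEquiv, htr, AddChar.map_sum]
  rw [← Fintype.prod_sum fun i (c : ZMod p) ↦
    ZMod.stdAddChar (Algebra.trace (ZMod p) F (v i * v i) * c ^ 2)]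
  simp only [sum_addChar_mul_sq hp2 (ZMod.isPrimitive_stdAddChar p) (hne _),
    Finset.prod_mul_distrib, Finset.prod_const, Finset.card_univ, Fintype.card_fin]
  rw [← Int.cast_prod, ← map_prod, ← hdiscr,
    (quadraticChar_one_iff_isSquare hdne).2 (isSquare_discr_of_odd_finrank rfl hodd v)]
  simp

/-- The quadratic Gauss sum over a field of odd degree over `ZMod p`, for `p ≡ 3 (mod 4)`. -/
theorem gaussSum_quadraticChar_of_odd_finrank [DecidableEq F] (hp : p % 4 = 3)
    (hodd : Odd (Module.finrank (ZMod p) F)) {ψ : AddChar F ℂ} (hψ : ψ ≠ 1)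
    (hψtr : ∀ x, ψ x = ZMod.stdAddChar (Algebra.trace (ZMod p) F x)) :
    gaussSum ((quadraticChar F).ringHomComp (Int.castRingHom ℂ)) ψ =
      (Complex.I * (Real.sqrt p : ℝ)) ^ Module.finrank (ZMod p) F := by
  have := charP_of_injective_algebraMap (algebraMap (ZMod p) F).injective p
  have hF : ringChar F ≠ 2 := by rw [ringChar.eq F p]; lia
  rw [← sum_addChar_sq_eq_gaussSum hF hψ]
  simp only [hψtr]
  rw [sum_stdAddChar_trace_sq (by lia) hodd, gaussSum_quadraticChar_zmod hp]

end

lemma prod_range_add_of_add_eq {M : Type*} [CancelCommMonoid M] {f : ℕ → M} {N : ℕ}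
    (hf : ∀ k, f (k + N) = f k) (t : ℕ) :
    ∏ k ∈ Finset.range N, f (k + t) = ∏ k ∈ Finset.range N, f k := by
  induction t with
  | zero => rfl
  | succ t ih =>
    rw [← ih]
    refine mul_right_cancel (b := f t) ?_
    have h := Finset.prod_range_succ' (fun k ↦ f (k + t)) N
    rw [Finset.prod_range_succ, add_comm N t, hf, zero_add] at h
    rw [h]
    congr 2
    funext k
    congr 1
    ring

lemma prod_range_two_mul_of_mul_reflect {M : Type*} [CommMonoid M] {f : ℕ → M} {s : ℕ} {c : M}
    (hf : ∀ k < s, f k * f (2 * s - 1 - k) = c) : ∏ k ∈ Finset.range (2 * s), f k = c ^ s := by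
  rw [two_mul, Finset.prod_range_add, ← Finset.prod_range_reflect (fun k ↦ f (s + k)),
    ← Finset.prod_mul_distrib, Finset.prod_congr rfl (g := fun _ ↦ c), Finset.prod_const,
    Finset.card_range]
  intro k hk
  have := Finset.mem_range.1 hk
  rw [← hf k this]
  congr 2
  lia

lemma MulChar.eq_pow_of_forall_mem_zpowers {F R : Type*} [Field F] [CommRing R]
    {χ η : MulChar F R} {m : ℕ}
    (hχ : ∀ ψ : MulChar F R, ψ ∈ Subgroup.zpowers χ) (hm : orderOf χ = 2 * m)
    (hη : η ^ 2 = 1) (hη1 : η ≠ 1) : η = χ ^ m := by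
  obtain ⟨k, rfl⟩ := Subgroup.mem_zpowers_iff.1 (hχ η)
  have h := orderOf_dvd_iff_zpow_eq_one (x := χ) (i := k * 2)
  rw [zpow_mul, zpow_ofNat, hm] at h
  obtain ⟨t, ht⟩ := h.2 hη
  have hk : k = m * t := by push_cast at ht; linarith
  rcases Int.even_or_odd' t with ⟨u, rfl | rfl⟩
  · refine absurd ?_ hη1
    rw [← orderOf_dvd_iff_zpow_eq_one, hm]
    exact ⟨u, by rw [hk]; push_cast; ring⟩
  · have : χ ^ (2 * m) = 1 := hm ▸ pow_orderOf_eq_one χ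
    rw [hk, show (m : ℤ) * (2 * u + 1) = (2 * m : ℕ) * u + m by push_cast; ring, zpow_add,
      zpow_mul, zpow_natCast, zpow_natCast, this, one_zpow, one_mul]

section
variable {F : Type*} [Field F] [Fintype F]

lemma gaussSum_mul_gaussSum_inv_eq {χ : MulChar F ℂ} (hχ : χ ≠ 1) {ψ : AddChar F ℂ}
    (hψ : ψ.IsPrimitive) :
    gaussSum χ ψ * gaussSum χ⁻¹ ψ = χ (-1) * Fintype.card F := by
  rw [← mul_gaussSum_inv_eq_gaussSum χ⁻¹, mul_left_comm, gaussSum_mul_gaussSum_eq_card hχ hψ,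
    MulChar.inv_apply', inv_neg_one]

/-- Products of Jacobi sums `J(χ^r, χ^(2k))` with `r` odd, in terms of Gauss sums. -/
lemma prod_jacobiSum_mul_gaussSum {χ : MulChar F ℂ} {s : ℕ} (hord : orderOf χ = 2 * (2 * s + 1))
    (hneg : χ (-1) = -1) {ψ : AddChar F ℂ} (hψ : ψ ≠ 1) {r : ℕ} (hr : Odd r) :
    (∏ k ∈ Finset.range (2 * s + 1), jacobiSum (χ ^ r) (χ ^ (2 * k))) *
        gaussSum (χ ^ (2 * s + 1)) ψ =
      -((-1) ^ s * gaussSum (χ ^ r) ψ ^ (2 * s + 1)) := by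
  have hprim := AddChar.IsPrimitive.of_ne_one hψ
  have hq : (Fintype.card F : ℂ) ≠ 0 := by exact_mod_cast Fintype.card_ne_zero
  have hodd {j : ℕ} (hj : Odd j) : χ ^ j ≠ 1 := by
    rw [Ne, ← orderOf_dvd_iff_pow_eq_one, hord]
    rintro ⟨c, rfl⟩
    exact Nat.not_odd_iff_even.2 (even_two.mul_right _ |>.mul_right c) hj
  have hG {j : ℕ} (hj : Odd j) : gaussSum (χ ^ j) ψ ≠ 0 :=
    gaussSum_ne_zero_of_nontrivial hq (hodd hj) hprim
  have hpow : χ ^ (2 * (2 * s + 1)) = 1 := hord ▸ pow_orderOf_eq_one χ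
  have hinv {i j : ℕ} (hij : i + j = 2 * (2 * s + 1)) : χ ^ j = (χ ^ i)⁻¹ :=
    eq_inv_of_mul_eq_one_right (by rw [← pow_add, hij, hpow])
  have heven : ∏ k ∈ Finset.range (2 * s + 1), gaussSum (χ ^ (2 * k)) ψ =
      -(Fintype.card F : ℂ) ^ s := by
    rw [Finset.prod_range_succ', mul_zero, pow_zero, gaussSum_one_left hψ,
      prod_range_two_mul_of_mul_reflect (c := (Fintype.card F : ℂ)), mul_neg_one]
    intro k hk
    have hne : χ ^ (2 * (k + 1)) ≠ 1 := pow_ne_one_of_lt_orderOf (by lia) (by lia)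
    rw [hinv (i := 2 * (k + 1)) (j := 2 * (2 * s - 1 - k + 1)) (by lia),
      gaussSum_mul_gaussSum_inv_eq hne hprim, MulChar.pow_apply' _ (by lia), hneg]
    simp [pow_mul]
  have hodds : ∏ k ∈ Finset.range (2 * s + 1), gaussSum (χ ^ (2 * k + 1)) ψ =
      (-(Fintype.card F : ℂ)) ^ s * gaussSum (χ ^ (2 * s + 1)) ψ := by
    have hpair (k : ℕ) (hk : k < s) : gaussSum (χ ^ (2 * k + 1)) ψ *
        gaussSum (χ ^ (2 * (2 * s - k) + 1)) ψ = -(Fintype.card F : ℂ) := by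
      rw [hinv (i := 2 * k + 1) (j := 2 * (2 * s - k) + 1) (by lia),
        gaussSum_mul_gaussSum_inv_eq (hodd (odd_two_mul_add_one k)) hprim,
        MulChar.pow_apply' _ (by lia), hneg, (odd_two_mul_add_one k).neg_one_pow, neg_one_mul]
    rw [show 2 * s + 1 = s + (s + 1) by ring, Finset.prod_range_add, Finset.prod_range_succ',
      ← Finset.prod_range_reflect (fun k ↦ gaussSum (χ ^ (2 * (s + (k + 1)) + 1)) ψ), ← mul_assoc,
      ← Finset.prod_mul_distrib, Finset.prod_congr rfl (g := fun _ ↦ -(Fintype.card F : ℂ)),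
      Finset.prod_const, Finset.card_range, add_zero, two_mul, add_assoc]
    intro k hk
    have hk' := Finset.mem_range.1 hk
    rw [← hpair k hk']
    congr 4
    lia
  have hshift : ∏ k ∈ Finset.range (2 * s + 1), gaussSum (χ ^ (r + 2 * k)) ψ =
      ∏ k ∈ Finset.range (2 * s + 1), gaussSum (χ ^ (2 * k + 1)) ψ := by
    obtain ⟨t, rfl⟩ := hr
    have := prod_range_add_of_add_eq (M := ℂˣ) (N := 2 * s + 1)
      (f := fun k ↦ Units.mk0 (gaussSum (χ ^ (2 * k + 1)) ψ) (hG (odd_two_mul_add_one k)))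
      (fun k ↦ by
        ext
        simp only [Units.val_mk0]
        rw [show 2 * (k + (2 * s + 1)) + 1 = 2 * k + 1 + 2 * (2 * s + 1) by ring, pow_add, hpow,
          mul_one]) t
    have := congrArg Units.val this
    simp only [Units.coe_prod, Units.val_mk0] at this
    rw [← this]
    refine Finset.prod_congr rfl fun k _ ↦ ?_
    rw [show 2 * t + 1 + 2 * k = 2 * (k + t) + 1 by ring]
  have hJ : (∏ k ∈ Finset.range (2 * s + 1), jacobiSum (χ ^ r) (χ ^ (2 * k))) *
      ∏ k ∈ Finset.range (2 * s + 1), gaussSum (χ ^ (r + 2 * k)) ψ =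
      gaussSum (χ ^ r) ψ ^ (2 * s + 1) *
        ∏ k ∈ Finset.range (2 * s + 1), gaussSum (χ ^ (2 * k)) ψ := by
    rw [← Finset.prod_mul_distrib]
    nth_rewrite 2 [← Finset.card_range (2 * s + 1)]
    rw [← Finset.prod_const, ← Finset.prod_mul_distrib]
    refine Finset.prod_congr rfl fun k _ ↦ ?_
    rw [mul_comm, pow_add]
    exact jacobiSum_mul_nontrivial (pow_add χ r (2 * k) ▸ hodd (hr.add_even (even_two_mul k))) ψ
  rw [hshift, hodds, heven, neg_pow] at hJ
  have hs : ((-1 : ℂ) ^ s) * (-1) ^ s = 1 := by rw [← mul_pow]; simp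
  refine mul_right_cancel₀ (pow_ne_zero s hq) ?_
  linear_combination (-1) ^ s * hJ -
    (∏ k ∈ Finset.range (2 * s + 1), jacobiSum (χ ^ r) (χ ^ (2 * k))) *
      gaussSum (χ ^ (2 * s + 1)) ψ * (Fintype.card F : ℂ) ^ s * hs

end

/-- For `q = p^n ≡ 3 (mod 4)`, `χ` a generator of the character group of
`F_q^×` and `1 ≤ r ≤ q-2` odd,
`∏_{k=0}^{(q-3)/2} J_q(χ^r, χ^{2k}) = (-1)^{(q-3)/4} · i^n · G_q(χ^r)^{(q-1)/2} / √q`,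
where `G_q(χ^r) = Σ_x χ^r(x) ζ_p^{Tr(x)}`. -/
theorem prod_jacobiSum_odd_r (p n q : ℕ) [Fact p.Prime] (hn : 0 < n) (hq : q = p ^ n)
    (hq3 : q % 4 = 3)
    (F : Type*) [Field F] [Fintype F] [Algebra (ZMod p) F] (hcard : Fintype.card F = q)
    (χ : MulChar F ℂ) (hχ : ∀ ψ : MulChar F ℂ, ψ ∈ Subgroup.zpowers χ)
    (r : ℕ) (hr1 : 1 ≤ r) (hr2 : r ≤ q - 2) (hrodd : Odd r) :
    ∏ k ∈ Finset.range ((q - 1) / 2), jacobiSum (χ ^ r) (χ ^ (2 * k))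
      = (-1 : ℂ) ^ ((q - 3) / 4) * Complex.I ^ n
          * (∑ x : F, (χ ^ r) x
              * Complex.exp (2 * Real.pi * Complex.I
                  * ((Algebra.trace (ZMod p) F x).val : ℂ) / p)) ^ ((q - 1) / 2)
          / Real.sqrt q := by
  classical
  obtain ⟨s, hs⟩ : ∃ s, q = 4 * s + 3 := ⟨q / 4, by lia⟩
  have hp4 : p % 4 < 4 := Nat.mod_lt _ (by norm_num)
  have hpn : p % 4 = 3 ∧ Odd n := by
    rcases Nat.even_or_odd' n with ⟨t, rfl | rfl⟩
    · exfalso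
      rw [hq, pow_mul, Nat.pow_mod, Nat.pow_mod p] at hq3
      interval_cases h : p % 4 <;> rcases t with _ | t <;> simp_all [pow_succ]
    · refine ⟨?_, odd_two_mul_add_one t⟩
      rw [hq, pow_succ, pow_mul, Nat.mul_mod, Nat.pow_mod, Nat.pow_mod p] at hq3
      interval_cases h : p % 4 <;> rcases t with _ | t <;> simp_all [pow_succ]
  obtain ⟨hp3, hnodd⟩ := hpn
  have hfin : Module.finrank (ZMod p) F = n := by
    have h := Module.card_eq_pow_finrank (K := ZMod p) (V := F)
    rw [hcard, hq, ZMod.card] at h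
    exact (Nat.pow_right_injective (Fact.out : p.Prime).two_le h).symm
  have := charP_of_injective_algebraMap (algebraMap (ZMod p) F).injective p
  have hF : ringChar F ≠ 2 := by rw [ringChar.eq F p]; lia
  let ψ : AddChar F ℂ :=
    ZMod.stdAddChar.compAddMonoidHom (Algebra.trace (ZMod p) F).toAddMonoidHom
  have hψapply (x : F) : ψ x = ZMod.stdAddChar (Algebra.trace (ZMod p) F x) := rfl
  have hψ : ψ ≠ 1 := by
    obtain ⟨x, hx⟩ := Algebra.trace_surjective (ZMod p) F 1
    intro h
    have h1 : ZMod.stdAddChar (1 : ZMod p) = (1 : ℂ) := by rw [← hx, ← hψapply, h]; rfl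
    rw [← AddChar.map_zero_eq_one (ZMod.stdAddChar (N := p)),
      ZMod.injective_stdAddChar.eq_iff] at h1
    exact one_ne_zero h1
  have hgauss (φ : MulChar F ℂ) : ∑ x : F, φ x * Complex.exp (2 * Real.pi * Complex.I
      * ((Algebra.trace (ZMod p) F x).val : ℂ) / p) = gaussSum φ ψ := by
    refine Finset.sum_congr rfl fun x _ ↦ ?_
    rw [hψapply, ZMod.stdAddChar_apply, ZMod.toCircle_apply]
  have hord : orderOf χ = 2 * (2 * s + 1) := by
    rw [orderOf_eq_card_of_forall_mem_zpowers hχ,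
      MulChar.card_eq_card_units_of_hasEnoughRootsOfUnity, Nat.card_units,
      Nat.card_eq_fintype_card, hcard]
    lia
  set η := (quadraticChar F).ringHomComp (Int.castRingHom ℂ) with hη
  have hη2 : η ^ 2 = 1 := ((quadraticChar_isQuadratic F).comp _).sq_eq_one
  have hη1 : η ≠ 1 := (MulChar.ringHomComp_ne_one_iff (Int.castRingHom ℂ).injective_int).2
    (quadraticChar_ne_one hF)
  have hηχ : η = χ ^ (2 * s + 1) := MulChar.eq_pow_of_forall_mem_zpowers hχ hord hη2 hη1
  have hneg : χ (-1) = -1 := by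
    have h1 : η (-1) = -1 := by
      have : quadraticChar F (-1) = -1 := by
        rw [quadraticChar_neg_one_iff_not_isSquare, FiniteField.isSquare_neg_one_iff, hcard]
        simpa using hq3
      simp [hη, MulChar.ringHomComp_apply, this]
    have h2 : χ (-1) ^ 2 = 1 := by rw [← map_pow]; simp
    rw [hηχ, MulChar.pow_apply' _ (by lia), pow_succ, pow_mul, h2, one_pow, one_mul] at h1
    exact h1
  have hGη : gaussSum (χ ^ (2 * s + 1)) ψ = Complex.I ^ n * (Real.sqrt q : ℝ) := by
    have hsqrt : Real.sqrt q = Real.sqrt p ^ n := by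
      rw [hq, Nat.cast_pow, Real.sqrt_eq_iff_eq_sq (by positivity) (by positivity), ← pow_mul,
        mul_comm, pow_mul, Real.sq_sqrt (by positivity)]
    rw [← hηχ, hη, gaussSum_quadraticChar_of_odd_finrank hp3 (hfin ▸ hnodd) hψ hψapply, hfin,
      mul_pow, hsqrt, Complex.ofReal_pow]
  have hsq : ((Real.sqrt q : ℝ) : ℂ) ≠ 0 := by
    rw [Ne, Complex.ofReal_eq_zero, Real.sqrt_eq_zero (by positivity)]
    exact_mod_cast (by lia : q ≠ 0)
  have hI : (Complex.I ^ n) * Complex.I ^ n = -1 := by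
    rw [← mul_pow, Complex.I_mul_I, hnodd.neg_one_pow]
  have key := prod_jacobiSum_mul_gaussSum hord hneg hψ hrodd
  rw [hGη] at key
  rw [hgauss, show (q - 1) / 2 = 2 * s + 1 by lia, show (q - 3) / 4 = s by lia, eq_div_iff hsq]
  linear_combination -Complex.I ^ n * key +
    (∏ k ∈ Finset.range (2 * s + 1), jacobiSum (χ ^ r) (χ ^ (2 * k))) * (Real.sqrt q : ℝ) * hI
end

section
/- Let p ≡ 3 (mod 4) be a prime with p > 3, and let h(-p) be the class number of the imaginary quadratic field Q(√(-p)). Then the product ∏_{k=0}^{(p-3)/2} (2k+1), taken modulo p, satisfies -∏_{k=0}^{(p-3)/2}(2k+1) ≡ (-1)^{(p+1)/4 + (h(-p)+1)/2} (mod p). -/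
open Polynomial in
theorem sum_pow_mul_descFactorial (p m : ℕ) [Fact p.Prime] (hm : p = 2 * m + 1) :
    ∑ j ∈ Finset.range p, (j : ZMod p) ^ m * (j.descFactorial m : ZMod p) = -1 := by
  have hp : p.Prime := Fact.out
  have hm0 : 0 < m := by have := hp.two_le; omega
  set P : (ZMod p)[X] := X ^ m * descPochhammer (ZMod p) m with hP
  have hmon : P.Monic := (monic_X_pow m).mul (monic_descPochhammer (ZMod p) m)
  have hdeg : P.natDegree = 2 * m := by
    rw [hP, (monic_X_pow m).natDegree_mul (monic_descPochhammer (ZMod p) m), natDegree_X_pow,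
      descPochhammer_natDegree]
    ring
  have h1 : ∑ j ∈ Finset.range p, (j : ZMod p) ^ m * (j.descFactorial m : ZMod p)
      = ∑ x : ZMod p, P.eval x := by
    refine Finset.sum_bij (fun j _ => (j : ZMod p)) (by simp) ?_ ?_ ?_
    · intro a ha b hb hab
      rw [ZMod.natCast_eq_natCast_iff'] at hab
      rwa [Nat.mod_eq_of_lt (Finset.mem_range.1 ha),
        Nat.mod_eq_of_lt (Finset.mem_range.1 hb)] at hab
    · intro x _
      exact ⟨x.val, Finset.mem_range.2 x.val_lt, by simp⟩
    · intro j _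
      simp [hP, descPochhammer_eval_eq_descFactorial]
  rw [h1]
  simp_rw [eval_eq_sum_range, hdeg]
  rw [Finset.sum_comm, Finset.sum_range_succ, Finset.sum_eq_zero, zero_add, ← Finset.mul_sum]
  · have : P.coeff (2 * m) = 1 := by rw [← hdeg]; exact hmon
    rw [this, one_mul]
    have hpow : ∀ x : ZMod p, x ^ (2 * m) = 1 - if x = 0 then 1 else 0 := by
      intro x
      split_ifs with hx
      · rw [hx, zero_pow (by omega), sub_self]
      · rw [← ZMod.pow_card_sub_one_eq_one hx, sub_zero]
        congr 1
        omega
    simp [hpow]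
  · intro i hi
    rw [← Finset.mul_sum, FiniteField.sum_pow_lt_card_sub_one, mul_zero]
    rw [ZMod.card, hm]
    simpa using hi

open Polynomial in
theorem X_sub_one_pow_dvd_of_aeval_eq_zero (p : ℕ) [Fact p.Prime] {ζ : ℂ} (hζ : IsPrimitiveRoot ζ p)
    (F : ℤ[X]) (hF : aeval ζ F = 0) :
    (X - 1 : (ZMod p)[X]) ^ (p - 1) ∣ F.map (Int.castRingHom (ZMod p)) := by
  have hp : p.Prime := Fact.out
  have h1 : cyclotomic p ℤ ∣ F := by
    rw [cyclotomic_eq_minpoly hζ hp.pos]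
    exact minpoly.isIntegrallyClosed_dvd (hζ.isIntegral hp.pos) hF
  have h2 := Polynomial.map_dvd (Int.castRingHom (ZMod p)) h1
  rw [map_cyclotomic] at h2
  have h3 : cyclotomic p (ZMod p) = (X - 1) ^ (p - 1) := by
    have hX : (X - 1 : (ZMod p)[X]) ≠ 0 := by simpa using X_sub_C_ne_zero (1 : ZMod p)
    refine mul_right_cancel₀ hX ?_
    rw [cyclotomic_prime_mul_X_sub_one, ← pow_succ, Nat.sub_add_cancel hp.one_le, sub_pow_char]
    simp
  rwa [h3] at h2

theorem factorial_sq_eq_one (p m : ℕ) [Fact p.Prime] (hm : p = 2 * m + 1) (hodd : Odd m) :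
    (m.factorial : ZMod p) ^ 2 = 1 := by
  have hw := ZMod.wilsons_lemma p
  have h1 : ((p - 1).factorial : ZMod p) =
      m.factorial * ∏ k ∈ Finset.range m, (-((k : ZMod p) + 1)) := by
    have : p - 1 = m + m := by omega
    rw [this, ← Nat.factorial_mul_ascFactorial, Nat.cast_mul, Nat.ascFactorial_eq_prod_range,
      ← Finset.prod_range_reflect, Nat.cast_prod]
    congr 1
    refine Finset.prod_congr rfl fun k hk => ?_
    have hk := Finset.mem_range.1 hk
    have : ((m + 1 + (m - 1 - k) + (k + 1) : ℕ) : ZMod p) = ((p : ℕ) : ZMod p) := by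
      congr 1; omega
    rw [ZMod.natCast_self, Nat.cast_add _ (k + 1)] at this
    push_cast at this ⊢
    linear_combination this
  have h2 : ∏ k ∈ Finset.range m, (-((k : ZMod p) + 1)) = - m.factorial := by
    rw [Finset.prod_neg, Finset.card_range, hodd.neg_one_pow,
      ← Finset.prod_range_add_one_eq_factorial]
    push_cast; ring
  rw [h1, h2] at hw
  linear_combination -hw

open Polynomial in
theorem eq_neg_two_pow_of_gauss_eq (p m : ℕ) [Fact p.Prime] (hm : p = 2 * m + 1) (hodd : Odd m)
    {ζ : ℂ} (hζ : IsPrimitiveRoot ζ p) (ε : ℤ) (hε : ε = 1 ∨ ε = -1)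
    (h : ∑ j ∈ Finset.range p, ((quadraticChar (ZMod p) (j : ZMod p) : ℤ) : ℂ) * ζ ^ j
      = ε * ∏ k ∈ Finset.range m, (ζ ^ (k + 1) - ζ ^ (p - (k + 1)))) :
    (ε : ZMod p) = - 2 ^ m := by
  have hp : p.Prime := Fact.out
  set F : ℤ[X] := ∑ j ∈ Finset.range p, C (quadraticChar (ZMod p) (j : ZMod p)) * X ^ j
    - C ε * ∏ k ∈ Finset.range m, (X ^ (k + 1) - X ^ (p - (k + 1))) with hFdef
  have hF : aeval ζ F = 0 := by
    simp only [hFdef, map_sub, map_sum, map_prod, map_mul, map_pow, aeval_X, aeval_C]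
    simpa [sub_eq_zero] using h
  obtain ⟨Q, hQ⟩ := X_sub_one_pow_dvd_of_aeval_eq_zero p hζ F hF
  have hm1 : m < p - 1 := by have := hodd.pos; omega
  have key : eval 1 (derivative^[m] (F.map (Int.castRingHom (ZMod p)))) = 0 := by
    have := aeval_iterate_derivative_of_lt (F.map (Int.castRingHom (ZMod p))) (p - 1)
      (1 : ZMod p) (p' := Q) (by simpa using hQ) hm1
    simpa using this
  have hg : ∀ k : ℕ, ∃ g : (ZMod p)[X], k < m →
      (X ^ (k + 1) - X ^ (p - (k + 1)) = (X - C 1) * g ∧ g.eval 1 = 2 * ((k : ZMod p) + 1)) := by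
    intro k
    have hr : IsRoot (X ^ (k + 1) - X ^ (p - (k + 1)) : (ZMod p)[X]) 1 := by simp
    obtain ⟨g, hg⟩ := dvd_iff_isRoot.2 hr
    refine ⟨g, fun hk => ⟨hg, ?_⟩⟩
    have hd := congrArg (fun q => eval 1 (derivative q)) hg
    simp only [derivative_sub, derivative_X_pow, derivative_mul, derivative_X, derivative_C] at hd
    simp only [eval_sub, eval_mul, eval_add, eval_pow, eval_X, eval_C, one_pow, eval_one,
      eval_zero] at hd
    rw [Nat.cast_sub (by omega), ZMod.natCast_self] at hd
    push_cast at hd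
    linear_combination -hd
  choose g hg using hg
  have hB : ∏ k ∈ Finset.range m, (X ^ (k + 1) - X ^ (p - (k + 1)) : (ZMod p)[X])
      = (X - C 1) ^ m * ∏ k ∈ Finset.range m, g k := by
    rw [Finset.prod_congr rfl fun k hk => (hg k (Finset.mem_range.1 hk)).1, Finset.prod_mul_distrib]
    simp
  have hBd : eval 1 (derivative^[m] (∏ k ∈ Finset.range m,
      (X ^ (k + 1) - X ^ (p - (k + 1)) : (ZMod p)[X]))) = 2 ^ m := by
    have := aeval_iterate_derivative_self (∏ k ∈ Finset.range m,
      (X ^ (k + 1) - X ^ (p - (k + 1)) : (ZMod p)[X])) m (1 : ZMod p)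
      (p' := ∏ k ∈ Finset.range m, g k) (by simpa using hB)
    rw [coe_aeval_eq_eval] at this
    rw [this, eval_prod, Finset.prod_congr rfl fun k hk => (hg k (Finset.mem_range.1 hk)).2,
      Finset.prod_mul_distrib]
    have h1 := factorial_sq_eq_one p m hm hodd
    have h2 : ∏ k ∈ Finset.range m, ((k : ZMod p) + 1) = m.factorial := by
      rw [← Finset.prod_range_add_one_eq_factorial]; push_cast; rfl
    rw [h2]
    simp only [Finset.prod_const, Finset.card_range, nsmul_eq_mul]
    linear_combination 2 ^ m * h1
  have hchar : ∀ a : ZMod p, ((quadraticChar (ZMod p) a : ℤ) : ZMod p) = a ^ m := by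
    intro a
    have := quadraticChar_eq_pow_of_char_ne_two' (F := ZMod p)
      (by rw [ZMod.ringChar_zmod_n]; have := hodd.pos; omega) a
    rw [this, ZMod.card]; congr 1; omega
  have hA : eval 1 (derivative^[m] (∑ j ∈ Finset.range p,
      C ((quadraticChar (ZMod p) (j : ZMod p) : ℤ) : ZMod p) * X ^ j)) = -1 := by
    rw [iterate_derivative_sum, eval_finsetSum, ← sum_pow_mul_descFactorial p m hm]
    refine Finset.sum_congr rfl fun j _ => ?_
    rw [iterate_derivative_C_mul, iterate_derivative_X_pow_eq_natCast_mul, hchar]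
    simp
  have hmap : F.map (Int.castRingHom (ZMod p)) = ∑ j ∈ Finset.range p,
      C ((quadraticChar (ZMod p) (j : ZMod p) : ℤ) : ZMod p) * X ^ j
      - C (ε : ZMod p) * ∏ k ∈ Finset.range m, (X ^ (k + 1) - X ^ (p - (k + 1))) := by
    simp [hFdef, Polynomial.map_sub, Polynomial.map_sum, Polynomial.map_prod]
  rw [hmap, iterate_derivative_sub, iterate_derivative_C_mul, eval_sub, eval_mul, hA, hBd,
    eval_C] at key
  have hε2 : (ε : ZMod p) * ε = 1 := by rcases hε with rfl | rfl <;> simp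
  linear_combination (-(ε : ZMod p)) * key - 2 ^ m * hε2

theorem quadraticChar_two_eq (p n : ℕ) [Fact p.Prime] (hn : p = 4 * n + 3) :
    quadraticChar (ZMod p) 2 = (-1) ^ (n + 1) := by
  rw [quadraticChar_two (by rw [ZMod.ringChar_zmod_n]; omega), ZMod.card]
  rcases Nat.even_or_odd' n with ⟨k, rfl | rfl⟩
  · have : ((p : ℕ) : ZMod 8) = 3 := by
      have h8 : ((8 : ℕ) : ZMod 8) = 0 := ZMod.natCast_self 8
      rw [hn]; push_cast at h8 ⊢
      linear_combination (k : ZMod 8) * h8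
    rw [this, pow_succ, pow_mul, neg_one_sq, one_pow]
    decide
  · have : ((p : ℕ) : ZMod 8) = 7 := by
      have h8 : ((8 : ℕ) : ZMod 8) = 0 := ZMod.natCast_self 8
      rw [hn]; push_cast at h8 ⊢
      linear_combination (k : ZMod 8) * h8
    rw [this, show 2 * k + 1 + 1 = 2 * (k + 1) by ring, pow_mul, neg_one_sq, one_pow]
    decide

theorem two_pow_half_eq (p n : ℕ) [Fact p.Prime] (hn : p = 4 * n + 3) :
    (2 : ZMod p) ^ (2 * n + 1) = (-1) ^ (n + 1) := by
  have h := quadraticChar_eq_pow_of_char_ne_two' (F := ZMod p)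
    (by rw [ZMod.ringChar_zmod_n]; omega) 2
  rw [quadraticChar_two_eq p n hn, ZMod.card] at h
  rw [show 2 * n + 1 = p / 2 by omega, ← h]
  push_cast; rfl

theorem prod_pow_sub_pow_sq (p m : ℕ) (hm : p = 2 * m + 1) (hodd : Odd m)
    {ζ : ℂ} (hζ : IsPrimitiveRoot ζ p) :
    (∏ k ∈ Finset.range m, (ζ ^ (k + 1) - ζ ^ (p - (k + 1)))) ^ 2 = -p := by
  have hμ : IsPrimitiveRoot (ζ ^ 2) (2 * m + 1) := by
    rw [← hm]; exact hζ.pow_of_coprime 2 (by rw [hm]; simp)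
  have h1 := hμ.prod_one_sub_pow_eq_order
  rw [two_mul, Finset.prod_range_add, ← Finset.prod_range_reflect _ m,
    ← Finset.prod_mul_distrib] at h1
  rw [← Finset.prod_pow, ← Finset.prod_range_reflect]
  have h2 : ∏ k ∈ Finset.range m, (ζ ^ (m - 1 - k + 1) - ζ ^ (p - (m - 1 - k + 1))) ^ 2
      = ∏ k ∈ Finset.range m,
        (-((1 - (ζ ^ 2) ^ (m - 1 - k + 1)) * (1 - (ζ ^ 2) ^ (m + k + 1)))) := by
    refine Finset.prod_congr rfl fun k hk => ?_
    have hk := Finset.mem_range.1 hk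
    obtain ⟨a, ha⟩ : ∃ a, m = k + a + 1 := ⟨m - k - 1, by omega⟩
    have e1 : m - 1 - k + 1 = a + 1 := by omega
    have e2 : p - (a + 1) = m + k + 1 := by omega
    have e3 : ζ ^ (a + 1) * ζ ^ (m + k + 1) = 1 := by
      rw [← pow_add, ← hζ.pow_eq_one]; congr 1; omega
    rw [e1, e2, ← pow_mul, ← pow_mul, mul_comm 2, mul_comm 2, pow_mul, pow_mul]
    linear_combination (ζ ^ (a + 1) * ζ ^ (m + k + 1) - 1) * e3
  rw [h2, Finset.prod_neg, Finset.card_range, hodd.neg_one_pow]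
  rw [h1, hm]; push_cast; ring

theorem prod_pow_sub_pow_eq (p m : ℕ) (hm : p = 2 * m + 1) (hodd : Odd m) :
    ∏ k ∈ Finset.range m, (Complex.exp (2 * Real.pi * Complex.I / p) ^ (k + 1)
      - Complex.exp (2 * Real.pi * Complex.I / p) ^ (p - (k + 1)))
      = Complex.I ^ m * (Real.sqrt p : ℝ) := by
  set ζ := Complex.exp (2 * Real.pi * Complex.I / p) with hζ
  have hprim : IsPrimitiveRoot ζ p := Complex.isPrimitiveRoot_exp p (by omega)
  set R : ℝ := ∏ k ∈ Finset.range m, (2 * Real.sin (2 * Real.pi * (k + 1) / p)) with hR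
  have hRpos : 0 < R := by
    refine Finset.prod_pos fun k hk => ?_
    have hk : (k : ℝ) + 1 ≤ m := by exact_mod_cast Finset.mem_range.1 hk
    have hpm : (p : ℝ) = 2 * m + 1 := by exact_mod_cast hm
    have hpp : (0 : ℝ) < p := by rw [hpm]; positivity
    refine mul_pos two_pos (Real.sin_pos_of_pos_of_lt_pi (by positivity) ?_)
    rw [div_lt_iff₀ hpp, hpm]
    nlinarith [Real.pi_pos]
  have hprod : ∏ k ∈ Finset.range m, (ζ ^ (k + 1) - ζ ^ (p - (k + 1))) = Complex.I ^ m * R := by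
    have hI : Complex.I ^ m = ∏ k ∈ Finset.range m, Complex.I := by simp
    rw [hR, hI, Complex.ofReal_prod, ← Finset.prod_mul_distrib]
    refine Finset.prod_congr rfl fun k hk => ?_
    have hk := Finset.mem_range.1 hk
    have e1 : ζ ^ (p - (k + 1)) = (ζ ^ (k + 1))⁻¹ := by
      refine eq_inv_of_mul_eq_one_left ?_
      rw [← pow_add,
        Nat.sub_add_cancel (by omega), hprim.pow_eq_one]
    rw [e1, hζ, ← Complex.exp_nat_mul, ← Complex.exp_neg]
    push_cast
    rw [Complex.sin]
    have e2 : (k + 1 : ℂ) * (2 * Real.pi * Complex.I / p) =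
        2 * Real.pi * (k + 1) / p * Complex.I := by
      ring
    rw [e2, neg_mul]
    ring_nf
    rw [Complex.I_sq]; ring
  have hsq := prod_pow_sub_pow_sq p m hm hodd hprim
  rw [hprod, mul_pow, ← pow_mul, mul_comm m 2, pow_mul, Complex.I_sq, hodd.neg_one_pow] at hsq
  have hsq' : R ^ 2 = p := by
    have : ((R ^ 2 : ℝ) : ℂ) = ((p : ℝ) : ℂ) := by push_cast; linear_combination -hsq
    exact_mod_cast this
  rw [hprod, ← hsq', Real.sqrt_sq hRpos.le]

/-- The value, including the sign, of the quadratic Gauss sum modulo a prime `p ≡ 3 (mod 4)`. -/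
theorem gaussSum_quadraticChar_eq (p n : ℕ) [Fact p.Prime] (hn : p = 4 * n + 3) :
    gaussSum ((quadraticChar (ZMod p)).ringHomComp (Int.castRingHom ℂ)) ZMod.stdAddChar
      = Complex.I * (Real.sqrt p : ℝ) := by
  set χ := (quadraticChar (ZMod p)).ringHomComp (Int.castRingHom ℂ) with hχ
  set ζ := Complex.exp (2 * Real.pi * Complex.I / p) with hζ
  have hp : p.Prime := Fact.out
  have hm : p = 2 * (2 * n + 1) + 1 := by omega
  have hodd : Odd (2 * n + 1) := ⟨n, rfl⟩
  have hprim : IsPrimitiveRoot ζ p := Complex.isPrimitiveRoot_exp p (by omega)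
  have hring : ringChar (ZMod p) ≠ 2 := by rw [ZMod.ringChar_zmod_n]; omega
  have hneg : quadraticChar (ZMod p) (-1) = -1 := by
    rw [quadraticChar_neg_one hring, ZMod.card, ZMod.χ₄_nat_three_mod_four (by omega)]
  have hsum : gaussSum χ ZMod.stdAddChar = ∑ j ∈ Finset.range p,
      ((quadraticChar (ZMod p) (j : ZMod p) : ℤ) : ℂ) * ζ ^ j := by
    rw [gaussSum]
    symm
    refine Finset.sum_bij (fun j _ => (j : ZMod p)) (by simp) ?_ ?_ ?_
    · intro a ha b hb hab
      rw [ZMod.natCast_eq_natCast_iff'] at hab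
      rwa [Nat.mod_eq_of_lt (Finset.mem_range.1 ha),
        Nat.mod_eq_of_lt (Finset.mem_range.1 hb)] at hab
    · intro x _
      exact ⟨x.val, Finset.mem_range.2 x.val_lt, by simp⟩
    · intro j _
      have := ZMod.stdAddChar_coe (N := p) (j : ℤ)
      rw [Int.cast_natCast] at this
      rw [this, hζ, ← Complex.exp_nat_mul, hχ, MulChar.ringHomComp_apply]
      congr 2
      push_cast; ring
  have hne : χ ≠ 1 := by
    intro h
    have h1 : χ (-1) = (1 : MulChar (ZMod p) ℂ) (-1) := by rw [h]
    rw [hχ, MulChar.ringHomComp_apply, hneg, MulChar.one_apply isUnit_neg_one] at h1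
    norm_num at h1
  have hsq := gaussSum_sq hne ((quadraticChar_isQuadratic (ZMod p)).comp _)
    (ZMod.isPrimitive_stdAddChar p)
  rw [hχ, MulChar.ringHomComp_apply, hneg, ← hχ, ZMod.card] at hsq
  have hP2 := prod_pow_sub_pow_sq p _ hm hodd hprim
  have hP := prod_pow_sub_pow_eq p _ hm hodd
  rw [← hζ] at hP
  set P := ∏ k ∈ Finset.range (2 * n + 1), (ζ ^ (k + 1) - ζ ^ (p - (k + 1))) with hPdef
  have hτ : gaussSum χ ZMod.stdAddChar = P ∨ gaussSum χ ZMod.stdAddChar = -P := by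
    rw [← sq_eq_sq_iff_eq_or_eq_neg, hsq, hP2]
    simp
  obtain ⟨ε, hε, hετ⟩ : ∃ ε : ℤ, (ε = 1 ∨ ε = -1) ∧ gaussSum χ ZMod.stdAddChar = ε * P := by
    rcases hτ with h | h
    · exact ⟨1, Or.inl rfl, by simp [h]⟩
    · exact ⟨-1, Or.inr rfl, by simp [h]⟩
  have hmod := eq_neg_two_pow_of_gauss_eq p _ hm hodd hprim ε hε (by rw [← hsum, hετ])
  rw [two_pow_half_eq p n hn] at hmod
  have h11 : (1 : ZMod p) ≠ -1 := by
    have : Fact (2 < p) := ⟨by omega⟩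
    exact ZMod.neg_one_ne_one.symm
  have hεn : ε = (-1) ^ n := by
    rcases hε with rfl | rfl <;> rcases neg_one_pow_eq_or ℤ n with h | h <;> rw [h] <;>
      have h' := congrArg (Int.cast : ℤ → ZMod p) h <;> push_cast at h' hmod <;>
      rw [pow_succ, h'] at hmod <;> simp at hmod
    · exact absurd hmod h11
    · exact absurd hmod h11.symm
  rw [hετ, hP, hεn, pow_succ, pow_mul, Complex.I_sq]
  push_cast
  have : ((-1 : ℂ) ^ n) * (-1) ^ n = 1 := by rw [← mul_pow]; simp
  linear_combination (Complex.I * (Real.sqrt p : ℝ)) * this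

open Filter Topology MeasureTheory in
theorem exists_tendsto_LSeries_of_bounded_sum (f : ℕ → ℂ) (hf0 : f 0 = 0) (B : ℝ)
    (hB : ∀ n, ‖∑ k ∈ Finset.Icc 0 n, f k‖ ≤ B)
    (hsum : ∀ s : ℝ, 1 < s → LSeriesSummable f s) :
    ∃ l : ℂ, Tendsto (fun n : ℕ => ∑ k ∈ Finset.range n, f k / k) atTop (𝓝 l) ∧
      Tendsto (fun s : ℝ => LSeries f s) (𝓝[>] 1) (𝓝 l) := by
  have hIcc : ∀ n, ∑ k ∈ Finset.Icc 1 n, f k = ∑ k ∈ Finset.Icc 0 n, f k := by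
    intro n
    refine Finset.sum_subset (Finset.Icc_subset_Icc_left zero_le_one) fun k hk hk' => ?_
    have : k = 0 := by
      simp only [Finset.mem_Icc] at hk hk'
      omega
    rw [this, hf0]
  have hderiv : ∀ t : ℝ, 1 ≤ t → deriv (fun x : ℝ => (x : ℂ) ^ (-1 : ℂ)) t
      = -(t : ℂ) ^ (-2 : ℂ) := by
    intro t ht
    rw [Complex.deriv_ofReal_cpow_const (by linarith) (by simp)]
    norm_num
  have hcpow : ∀ (t : ℝ), 1 ≤ t → ∀ s : ℝ, ‖(t : ℂ) ^ (s : ℂ)‖ = t ^ s := by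
    intro t ht s
    rw [Complex.norm_cpow_eq_rpow_re_of_pos (by linarith), Complex.ofReal_re]
  have hint2 : IntegrableOn (fun t : ℝ => t ^ (-2 : ℝ)) (Set.Ioi 1) :=
    integrableOn_Ioi_rpow_of_lt (by norm_num) zero_lt_one
  refine ⟨∫ t in Set.Ioi (1 : ℝ), (∑ k ∈ Finset.Icc 0 ⌊t⌋₊, f k) * (t : ℂ) ^ (-2 : ℂ), ?_, ?_⟩
  · have h := tendsto_sum_mul_atTop_nhds_one_sub_integral₀ (𝕜 := ℂ) (c := f)
      (f := fun x : ℝ => (x : ℂ) ^ (-1 : ℂ)) hf0 (l := 0) (g := fun t => t ^ (-2 : ℝ))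
      ?_ ?_ ?_ ?_ ?_
    · have h' := h.comp (tendsto_sub_atTop_nat 1)
      have heq : (0 : ℂ) - ∫ t in Set.Ioi (1 : ℝ), deriv (fun x : ℝ => (x : ℂ) ^ (-1 : ℂ)) t *
          ∑ k ∈ Finset.Icc 0 ⌊t⌋₊, f k
          = ∫ t in Set.Ioi (1 : ℝ), (∑ k ∈ Finset.Icc 0 ⌊t⌋₊, f k) * (t : ℂ) ^ (-2 : ℂ) := by
        rw [zero_sub, ← integral_neg]
        refine setIntegral_congr_fun measurableSet_Ioi fun t ht => ?_
        simp only [hderiv t (le_of_lt ht)]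
        ring
      rw [heq] at h'
      refine h'.congr' ?_
      filter_upwards [eventually_ge_atTop 1] with n hn
      have : Finset.range n = Finset.Icc 0 (n - 1) := by
        ext k; simp only [Finset.mem_range, Finset.mem_Icc]; omega
      rw [this]
      refine Finset.sum_congr rfl fun k _ => ?_
      rw [Complex.ofReal_natCast, Complex.cpow_neg_one, div_eq_inv_mul]
    · intro t ht
      have ht0 : t ≠ 0 := by have : (1 : ℝ) ≤ t := ht; linarith
      exact (hasDerivAt_ofReal_cpow_const ht0 (r := -1) (by norm_num)).differentiableAt
    · have hc : ContinuousOn (fun t : ℝ => -(t : ℂ) ^ (-2 : ℂ)) (Set.Ici 1) := by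
        intro t ht
        have ht0 : t ≠ 0 := by have : (1 : ℝ) ≤ t := ht; linarith
        exact (Complex.continuousAt_ofReal_cpow_const t _ (Or.inr ht0)).neg.continuousWithinAt
      exact (hc.congr fun t ht => hderiv t ht).locallyIntegrableOn measurableSet_Ici
    · refine squeeze_zero_norm' (a := fun n : ℕ => (n : ℝ)⁻¹ * B) ?_ ?_
      · filter_upwards [eventually_ge_atTop 1] with n hn
        rw [norm_mul, Complex.ofReal_natCast, Complex.cpow_neg_one, norm_inv, Complex.norm_natCast]
        exact mul_le_mul_of_nonneg_left (hB n) (by positivity)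
      · simpa using (tendsto_inv_atTop_nhds_zero_nat (𝕜 := ℝ)).mul_const B
    · refine Asymptotics.IsBigO.of_bound B ?_
      filter_upwards [eventually_ge_atTop 1] with t ht
      have h2 := hcpow t ht (-2)
      push_cast at h2
      rw [norm_mul, hderiv t ht, norm_neg, h2, mul_comm, Real.norm_of_nonneg (by positivity)]
      exact mul_le_mul_of_nonneg_right (hB _) (by positivity)
    · exact ⟨Set.Ioi 1, Ioi_mem_atTop 1, hint2⟩
  · have hlim : Tendsto (fun s : ℝ => (s : ℂ) * ∫ t in Set.Ioi (1 : ℝ),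
        (∑ k ∈ Finset.Icc 0 ⌊t⌋₊, f k) * (t : ℂ) ^ (-((s : ℂ) + 1))) (𝓝[>] 1)
        (𝓝 ((1 : ℝ) * ∫ t in Set.Ioi (1 : ℝ),
          (∑ k ∈ Finset.Icc 0 ⌊t⌋₊, f k) * (t : ℂ) ^ (-2 : ℂ))) := by
      refine Tendsto.mul ?_ ?_
      · exact (Complex.continuous_ofReal.tendsto 1).mono_left nhdsWithin_le_nhds
      · refine tendsto_integral_filter_of_dominated_convergence (fun t => B * t ^ (-2 : ℝ))
            ?_ ?_ ?_ ?_
        · refine Eventually.of_forall fun s => ?_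
          refine Measurable.aestronglyMeasurable ?_
          refine Measurable.mul ?_ (by fun_prop)
          exact (measurable_from_nat (f := fun n => ∑ k ∈ Finset.Icc 0 n, f k)).comp
            Nat.measurable_floor
        · filter_upwards [self_mem_nhdsWithin] with s hs
          refine (ae_restrict_iff' measurableSet_Ioi).2 (Eventually.of_forall fun t ht => ?_)
          have ht1 : (1 : ℝ) ≤ t := le_of_lt ht
          rw [norm_mul]
          have := hcpow t ht1 (-(s + 1))
          push_cast at this
          rw [this]
          have hs : (1 : ℝ) < s := hs
          exact mul_le_mul (hB _) (Real.rpow_le_rpow_of_exponent_le ht1 (by linarith))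
            (by positivity) ((norm_nonneg _).trans (hB 0))
        · exact hint2.const_mul B
        · refine (ae_restrict_iff' measurableSet_Ioi).2 (Eventually.of_forall fun t ht => ?_)
          have ht1 : (1 : ℝ) < t := ht
          refine Tendsto.const_mul _ (Tendsto.mono_left ?_ nhdsWithin_le_nhds)
          have hc : ContinuousAt (fun s : ℝ => (t : ℂ) ^ (-((s : ℂ) + 1))) 1 := by
            refine ContinuousAt.const_cpow (by fun_prop) (Or.inl ?_)
            exact_mod_cast (by linarith : t ≠ 0)
          have := hc.tendsto
          rwa [show -(((1 : ℝ) : ℂ) + 1) = -2 by norm_num] at this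
    rw [Complex.ofReal_one, one_mul] at hlim
    refine hlim.congr' ?_
    filter_upwards [self_mem_nhdsWithin] with s hs
    have hs : (1 : ℝ) < s := hs
    rw [LSeries_eq_mul_integral f le_rfl (s := s) (by simp; linarith) (hsum s hs)]
    · simp_rw [hIcc]
    · simp only [hIcc, Real.rpow_zero]
      exact Asymptotics.IsBigO.of_bound B (Eventually.of_forall fun n => by simpa using hB n)
theorem log_one_sub_exp_mul_I {x : ℝ} (h0 : 0 < x) (h1 : x < 2 * Real.pi) :
    Complex.log (1 - Complex.exp (x * Complex.I)) =
      (Real.log (2 * Real.sin (x / 2)) : ℝ) + ((x - Real.pi) / 2 : ℝ) * Complex.I := by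
  have hs : 0 < 2 * Real.sin (x / 2) :=
    mul_pos two_pos (Real.sin_pos_of_pos_of_lt_pi (by linarith) (by linarith))
  have key : 1 - Complex.exp (x * Complex.I) = (2 * Real.sin (x / 2) : ℝ) *
      Complex.exp (((x - Real.pi) / 2 : ℝ) * Complex.I) := by
    obtain ⟨y, rfl⟩ : ∃ y, x = 2 * y := ⟨x / 2, by ring⟩
    have e1 : (2 * y - Real.pi) / 2 = y - Real.pi / 2 := by ring
    have h := Real.sin_sq_add_cos_sq y
    rw [Complex.exp_ofReal_mul_I, Complex.exp_ofReal_mul_I, e1, Real.cos_sub_pi_div_two,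
      Real.sin_sub_pi_div_two, Real.cos_two_mul, Real.sin_two_mul,
      mul_div_cancel_left₀ y two_ne_zero]
    generalize Real.sin y = u at *
    generalize Real.cos y = v at *
    apply Complex.ext
    · simp [-Complex.ofReal_pow]
      nlinarith
    · simp
      rw [← Complex.ofReal_pow, Complex.ofReal_im]
  rw [key, Complex.log_ofReal_mul hs (Complex.exp_ne_zero _), Complex.log_exp]
  · simp; linarith [Real.pi_pos]
  · simp; linarith [Real.pi_pos]

theorem tendsto_sum_mul_log (p : ℕ) [Fact p.Prime] (χ : MulChar (ZMod p) ℂ)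
    (hτ : ∀ n : ZMod p, gaussSum χ (ZMod.stdAddChar.mulShift n) = χ n * gaussSum χ ZMod.stdAddChar)
    (l : ℂ)
    (hl : Filter.Tendsto (fun n : ℕ => ∑ k ∈ Finset.range n, χ (k : ZMod p) / k)
      Filter.atTop (nhds l)) :
    gaussSum χ ZMod.stdAddChar * l =
      - ∑ a : ZMod p, χ a * Complex.log (1 - ZMod.stdAddChar a) := by
  have h1 := (Complex.tendsto_tsum_powerSeries_nhdsWithin_lt hl).const_mul
    (gaussSum χ ZMod.stdAddChar)
  rw [Filter.tendsto_map'_iff] at h1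
  refine tendsto_nhds_unique h1 ?_
  have hnorm (a : ZMod p) : ‖ZMod.stdAddChar a‖ = 1 := by
    rw [ZMod.stdAddChar_apply]; exact Circle.norm_coe _
  have h2 : ∀ r : ℝ, r ∈ Set.Ioo 0 1 → (- ∑ a : ZMod p, χ a *
      Complex.log (1 - ZMod.stdAddChar a * r)) =
      gaussSum χ ZMod.stdAddChar * ∑' n : ℕ, χ (n : ZMod p) / n * (r : ℂ) ^ n := by
    intro r hr
    have h3 : ∀ a : ZMod p, HasSum (fun n : ℕ => χ a * ((ZMod.stdAddChar a * r) ^ n / n))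
        (χ a * (- Complex.log (1 - ZMod.stdAddChar a * r))) := by
      intro a
      refine (Complex.hasSum_taylorSeries_neg_log ?_).mul_left _
      rw [norm_mul, hnorm, one_mul, Complex.norm_real, Real.norm_eq_abs, abs_of_pos hr.1]
      exact hr.2
    have h4 := hasSum_sum (s := Finset.univ) fun a _ => h3 a
    rw [← tsum_mul_left, ← Finset.sum_neg_distrib]
    simp only [← mul_neg]
    rw [← h4.tsum_eq]
    refine tsum_congr fun n => ?_
    have := hτ n
    rw [show gaussSum χ ZMod.stdAddChar * (χ (n : ZMod p) / n * (r : ℂ) ^ n)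
      = (χ (n : ZMod p) * gaussSum χ ZMod.stdAddChar) * (r ^ n / n) by ring, ← this, gaussSum,
      Finset.sum_mul]
    refine Finset.sum_congr rfl fun a _ => ?_
    rw [AddChar.mulShift_apply, ← nsmul_eq_mul, AddChar.map_nsmul_eq_pow, mul_pow]
    ring
  have h5 : Filter.Tendsto (fun r : ℝ => - ∑ a : ZMod p, χ a *
      Complex.log (1 - ZMod.stdAddChar a * r)) (nhdsWithin 1 (Set.Iio 1))
      (nhds (- ∑ a : ZMod p, χ a * Complex.log (1 - ZMod.stdAddChar a))) := by
    refine (tendsto_finsetSum _ fun a _ => ?_).neg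
    rcases eq_or_ne a 0 with rfl | ha
    · simp only [MulChar.map_zero, zero_mul, tendsto_const_nhds]
    refine Filter.Tendsto.const_mul _ ?_
    have hne : ZMod.stdAddChar a ≠ (1 : ℂ) := by
      intro h
      exact ha (ZMod.injective_stdAddChar (by rw [h, AddChar.map_zero_eq_one]))
    have hre : (ZMod.stdAddChar a : ℂ).re < 1 := by
      refine lt_of_le_of_ne ((Complex.re_le_norm _).trans (hnorm a).le) fun h => hne ?_
      have h6 := hnorm a
      rw [← sq_eq_sq₀ (norm_nonneg _) zero_le_one, ← Complex.normSq_eq_norm_sq,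
        Complex.normSq_apply, h] at h6
      have h7 : (ZMod.stdAddChar a : ℂ).im = 0 := by nlinarith
      exact Complex.ext h h7
    have hc : ContinuousAt (fun r : ℝ => Complex.log (1 - ZMod.stdAddChar a * r)) 1 := by
      refine ContinuousAt.clog (by fun_prop) ?_
      left
      simpa using hre
    have := hc.tendsto
    simp only [Complex.ofReal_one, mul_one] at this
    exact this.mono_left nhdsWithin_le_nhds
  refine h5.congr' ?_
  filter_upwards [Ioo_mem_nhdsLT (show (0 : ℝ) < 1 by norm_num)] with r hr using h2 r hr

theorem log_one_sub_stdAddChar (p : ℕ) [Fact p.Prime] (a : ZMod p) (ha : a ≠ 0) :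
    Complex.log (1 - ZMod.stdAddChar a) =
      (Real.log (2 * Real.sin (Real.pi * a.val / p)) : ℝ) +
        (Real.pi * (a.val / p - 1 / 2) : ℝ) * Complex.I := by
  have hp : (0 : ℝ) < p := by exact_mod_cast (Fact.out : p.Prime).pos
  have ha0 : (0 : ℝ) < a.val := by
    exact_mod_cast Nat.pos_of_ne_zero fun h => ha ((ZMod.val_eq_zero a).mp h)
  have hlt : (a.val : ℝ) < p := by exact_mod_cast a.val_lt
  have h : ZMod.stdAddChar a = Complex.exp ((2 * Real.pi * (a.val / p) : ℝ) * Complex.I) := by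
    have := ZMod.stdAddChar_coe (N := p) (a.val : ℤ)
    rw [Int.cast_natCast, ZMod.natCast_zmod_val] at this
    rw [this]
    congr 1
    push_cast
    ring
  rw [h, log_one_sub_exp_mul_I]
  · congr 5
    · ring
    · ring
  · have := Real.pi_pos
    positivity
  · have : (a.val : ℝ) / p < 1 := (div_lt_one hp).mpr hlt
    nlinarith [Real.pi_pos]

theorem sum_odd_mul_log_one_sub_stdAddChar (p : ℕ) [Fact p.Prime] (χ : MulChar (ZMod p) ℂ)
    (hχ : χ (-1) = -1) :
    ∑ a : ZMod p, χ a * Complex.log (1 - ZMod.stdAddChar a) =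
      Real.pi * Complex.I / p * ∑ a : ZMod p, χ a * a.val := by
  have hodd : ∀ a, χ (-a) = - χ a := fun a => by rw [← neg_one_mul a, map_mul, hχ, neg_one_mul]
  have h0 : ∑ a : ZMod p, χ a = 0 := by
    have h := Fintype.sum_equiv (Equiv.neg (ZMod p)) (fun a => χ (-a)) χ fun a => rfl
    simp only [hodd, Finset.sum_neg_distrib] at h
    exact self_eq_neg.mp h.symm
  have h1 : ∑ a : ZMod p, χ a * (Real.log (2 * Real.sin (Real.pi * a.val / p)) : ℝ) = 0 := by
    have h := Fintype.sum_equiv (Equiv.neg (ZMod p))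
      (fun a => χ (-a) * (Real.log (2 * Real.sin (Real.pi * (-a).val / p)) : ℝ))
      (fun a => χ a * (Real.log (2 * Real.sin (Real.pi * a.val / p)) : ℝ)) fun a => rfl
    have h2 : ∀ a : ZMod p, χ (-a) * (Real.log (2 * Real.sin (Real.pi * (-a).val / p)) : ℝ)
        = - (χ a * (Real.log (2 * Real.sin (Real.pi * a.val / p)) : ℝ)) := by
      intro a
      rw [hodd, neg_mul]
      rcases eq_or_ne a 0 with rfl | ha
      · simp
      have hp : (p : ℝ) ≠ 0 := by exact_mod_cast (Fact.out : p.Prime).ne_zero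
      have : NeZero a := ⟨ha⟩
      have e : Real.pi * ((-a).val : ℝ) / p = Real.pi - Real.pi * a.val / p := by
        rw [ZMod.val_neg_of_ne_zero, Nat.cast_sub a.val_lt.le]
        field_simp
      rw [e, Real.sin_pi_sub]
    simp only [h2, Finset.sum_neg_distrib] at h
    exact self_eq_neg.mp h.symm
  have h2 : ∀ a : ZMod p, χ a * Complex.log (1 - ZMod.stdAddChar a) =
      χ a * (Real.log (2 * Real.sin (Real.pi * a.val / p)) : ℝ)
      + (Real.pi * Complex.I / p * (χ a * a.val) - χ a * (Real.pi * Complex.I / 2)) := by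
    intro a
    rcases eq_or_ne a 0 with rfl | ha
    · simp [MulChar.map_zero]
    rw [log_one_sub_stdAddChar p a ha]
    push_cast
    ring
  simp only [h2, Finset.sum_add_distrib, Finset.sum_sub_distrib, ← Finset.mul_sum, ← Finset.sum_mul,
    h0, h1]
  ring

theorem sum_zmod_eq_sum_range {M : Type*} [AddCommMonoid M] (p : ℕ) [NeZero p] (f : ZMod p → M) :
    ∑ a : ZMod p, f a = ∑ k ∈ Finset.range p, f k :=
  Finset.sum_bij' (fun a _ => a.val) (fun k _ => (k : ZMod p))
    (fun a _ => Finset.mem_range.mpr a.val_lt) (fun _ _ => Finset.mem_univ _)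
    (fun a _ => ZMod.natCast_zmod_val a)
    (fun k hk => ZMod.val_cast_of_lt (Finset.mem_range.mp hk))
    (fun a _ => by rw [ZMod.natCast_zmod_val])

open Filter Topology in
/-- The value at `1` of the `L`-series of the quadratic character modulo `p ≡ 3 (mod 4)`, as a limit
from the right. -/
theorem tendsto_LSeries_quadraticChar (p n : ℕ) [Fact p.Prime] (hn : p = 4 * n + 3) :
    Tendsto (fun s : ℝ => LSeries (fun k : ℕ => ((quadraticChar (ZMod p) k : ℤ) : ℂ)) s) (𝓝[>] 1)
      (𝓝 (-(Real.pi / (p * Real.sqrt p) *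
        ∑ a : ZMod p, (quadraticChar (ZMod p) a : ℂ) * a.val))) := by
  set χ := (quadraticChar (ZMod p)).ringHomComp (Int.castRingHom ℂ) with hχdef
  have hχ : ∀ a, ((quadraticChar (ZMod p) a : ℤ) : ℂ) = χ a := fun a => rfl
  simp only [hχ]
  have hp2 : p ≠ 2 := by omega
  have hchar : ringChar (ZMod p) ≠ 2 := by rwa [ZMod.ringChar_zmod_n]
  have hsum : ∑ a, χ a = 0 := by
    simp only [← hχ]
    exact_mod_cast quadraticChar_sum_zero hchar
  have hneg : χ (-1) = -1 := by
    rw [← hχ, quadraticChar_neg_one hchar, ZMod.card, ZMod.χ₄_nat_three_mod_four (by omega)]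
    simp
  have hbound : ∀ a, ‖χ a‖ ≤ 1 := by
    intro a
    rw [← hχ]
    rcases quadraticChar_isQuadratic (ZMod p) a with h | h | h <;> rw [h] <;> simp
  have hperiod : ∀ N : ℕ, ∑ k ∈ Finset.range (p * N), χ (k : ZMod p) = 0 := by
    intro N
    induction N with
    | zero => simp
    | succ N ih =>
      rw [mul_add, mul_one, Finset.sum_range_add, ih, zero_add, ← hsum, sum_zmod_eq_sum_range]
      simp
  have hB : ∀ N : ℕ, ‖∑ k ∈ Finset.Icc 0 N, χ (k : ZMod p)‖ ≤ p := by
    intro N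
    have h1 : Finset.Icc 0 N = Finset.range (p * ((N + 1) / p) + (N + 1) % p) := by
      rw [Nat.div_add_mod]
      ext k
      simp only [Finset.mem_Icc, Finset.mem_range]
      omega
    rw [h1, Finset.sum_range_add, hperiod, zero_add]
    refine (norm_sum_le_of_le _ fun k _ => hbound _).trans ?_
    simp only [Finset.sum_const, Finset.card_range, nsmul_eq_mul, mul_one]
    exact_mod_cast (Nat.mod_lt _ (Fact.out : p.Prime).pos).le
  obtain ⟨l, hl1, hl2⟩ := exists_tendsto_LSeries_of_bounded_sum (fun k : ℕ => χ (k : ZMod p))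
    (by simp [MulChar.map_zero]) p hB
    (fun s hs => ZMod.LSeriesSummable_of_one_lt_re (fun a => χ a) (by simpa using hs))
  have hgauss := gaussSum_quadraticChar_eq p n hn
  rw [← hχdef] at hgauss
  have hτ : ∀ a : ZMod p, gaussSum χ (ZMod.stdAddChar.mulShift a)
      = χ a * gaussSum χ ZMod.stdAddChar := by
    intro a
    rcases eq_or_ne a 0 with rfl | ha
    · simp [gaussSum, hsum, MulChar.map_zero]
    · have hinv : χ⁻¹ = χ := ((quadraticChar_isQuadratic (ZMod p)).comp _).inv
      have h := gaussSum_mulShift_eq χ ZMod.stdAddChar (Units.mk0 a ha)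
      rwa [hinv] at h
  have h1 := tendsto_sum_mul_log p χ hτ l hl1
  rw [sum_odd_mul_log_one_sub_stdAddChar p χ hneg, hgauss] at h1
  have hp0 : (0 : ℝ) < p := by exact_mod_cast (Fact.out : p.Prime).pos
  have hs0 : ((Real.sqrt p : ℝ) : ℂ) ≠ 0 := by
    exact_mod_cast (Real.sqrt_pos.mpr hp0).ne'
  have hpc : (p : ℂ) ≠ 0 := by exact_mod_cast (Fact.out : p.Prime).ne_zero
  convert hl2 using 2
  apply mul_left_cancel₀ (mul_ne_zero Complex.I_ne_zero hs0)
  rw [h1]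
  field_simp

theorem sum_range_eq_sum_reflect (f : ℕ → ℤ) (P m : ℕ) (hP : P = 2 * m + 1) :
    ∑ k ∈ Finset.range P, f k =
      f 0 + ∑ j ∈ Finset.range m, (f (j + 1) + f (P - (j + 1))) := by
  subst hP
  rw [Finset.sum_range_succ', two_mul, Finset.sum_range_add, Finset.sum_add_distrib, add_comm,
    ← Finset.sum_range_reflect (fun j => f (m + j + 1))]
  congr 2
  refine Finset.sum_congr rfl fun j hj => ?_
  rw [Finset.mem_range] at hj
  congr 1
  omega

theorem sum_range_eq_sum_even (f : ℕ → ℤ) (P m : ℕ) (hP : P = 2 * m + 1) :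
    ∑ k ∈ Finset.range P, f k =
      f 0 + ∑ j ∈ Finset.range m, (f (2 * (j + 1)) + f (P - 2 * (j + 1))) := by
  subst hP
  have h : ∑ k ∈ Finset.range (2 * m + 1), f k =
      f 0 + ∑ j ∈ Finset.range m, (f (2 * (j + 1)) + f (2 * j + 1)) := by
    induction m with
    | zero => simp
    | succ m ih =>
      rw [show 2 * (m + 1) + 1 = 2 * m + 1 + 1 + 1 by ring, Finset.sum_range_succ,
        Finset.sum_range_succ, ih, Finset.sum_range_succ _ m,
        show 2 * (m + 1) = 2 * m + 1 + 1 by ring]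
      ring
  rw [h, Finset.sum_add_distrib, Finset.sum_add_distrib,
    ← Finset.sum_range_reflect (fun j => f (2 * j + 1))]
  congr 2
  refine Finset.sum_congr rfl fun j hj => ?_
  rw [Finset.mem_range] at hj
  congr 1
  omega

theorem exists_sum_eq_and_prod_eq_of_sign (ε : ℕ → ℤ) (m : ℕ)
    (hε : ∀ j < m, ε j = 1 ∨ ε j = -1) :
    ∃ N : ℕ, ∑ j ∈ Finset.range m, ε j = m - 2 * N ∧ ∏ j ∈ Finset.range m, ε j = (-1) ^ N := by
  induction m with
  | zero => exact ⟨0, by simp⟩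
  | succ m ih =>
    obtain ⟨N, h1, h2⟩ := ih fun j hj => hε j (by omega)
    rcases hε m (by omega) with h | h
    · refine ⟨N, ?_, ?_⟩
      · rw [Finset.sum_range_succ, h1, h]; push_cast; ring
      · rw [Finset.prod_range_succ, h2, h, mul_one]
    · refine ⟨N + 1, ?_, ?_⟩
      · rw [Finset.sum_range_succ, h1, h]; push_cast; ring
      · rw [Finset.prod_range_succ, h2, h, pow_succ]

theorem prod_odd_mul_two_pow_mul_factorial (m : ℕ) :
    (∏ k ∈ Finset.range m, (2 * k + 1)) * (2 ^ m * m.factorial) = (2 * m).factorial := by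
  induction m with
  | zero => simp
  | succ m ih =>
    rw [show 2 * (m + 1) = 2 * m + 1 + 1 by ring, Nat.factorial_succ (2 * m + 1),
      Nat.factorial_succ (2 * m), ← ih, Finset.prod_range_succ, Nat.factorial_succ m]
    ring

theorem two_sub_quadraticChar_mul_eq (p m : ℕ) [Fact p.Prime] (hm : p = 2 * m + 1)
    (hneg : quadraticChar (ZMod p) (-1) = -1) (h : ℤ)
    (hT : h * p = -∑ a : ZMod p, quadraticChar (ZMod p) a * a.val) :
    (2 - quadraticChar (ZMod p) 2) * h =
      ∑ j ∈ Finset.range m, quadraticChar (ZMod p) ((j + 1 : ℕ) : ZMod p) := by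
  have hp0 : (p : ℤ) ≠ 0 := by exact_mod_cast (Fact.out : p.Prime).ne_zero
  have h2 : (2 : ZMod p) ≠ 0 := by
    intro h
    have : p ∣ 2 := (ZMod.natCast_eq_zero_iff 2 p).mp (by exact_mod_cast h)
    have := Nat.le_of_dvd two_pos this
    have := (Fact.out : p.Prime).two_le
    omega
  set χ := quadraticChar (ZMod p) with hχ
  have hχ2 : χ 2 = 1 ∨ χ 2 = -1 := quadraticChar_dichotomy h2
  rw [sum_zmod_eq_sum_range] at hT
  have hval : ∀ k ∈ Finset.range p, χ (k : ZMod p) * ((k : ZMod p).val : ℤ) = χ (k : ZMod p) * k :=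
    fun k hk => by rw [ZMod.val_cast_of_lt (Finset.mem_range.mp hk)]
  rw [Finset.sum_congr rfl hval] at hT
  have hsub : ∀ k ≤ p, χ ((p - k : ℕ) : ZMod p) * ((p - k : ℕ) : ℤ)
      = χ (k : ZMod p) * k - p * χ (k : ZMod p) := by
    intro k hk
    rw [Nat.cast_sub hk, Nat.cast_sub hk, ZMod.natCast_self, zero_sub, ← neg_one_mul, map_mul, hneg]
    ring
  set S := ∑ j ∈ Finset.range m, χ ((j + 1 : ℕ) : ZMod p)
  set U := ∑ j ∈ Finset.range m, χ ((j + 1 : ℕ) : ZMod p) * ((j + 1 : ℕ) : ℤ)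
  have e1 : ∑ k ∈ Finset.range p, χ (k : ZMod p) * k = 2 * U - p * S := by
    rw [sum_range_eq_sum_reflect _ p m hm]
    simp only [Nat.cast_zero, mul_zero, zero_add]
    rw [Finset.mul_sum, Finset.mul_sum, ← Finset.sum_sub_distrib]
    refine Finset.sum_congr rfl fun j hj => ?_
    rw [Finset.mem_range] at hj
    rw [hsub _ (by omega)]
    ring
  have e2 : ∑ k ∈ Finset.range p, χ (k : ZMod p) * k = χ 2 * (4 * U - p * S) := by
    rw [sum_range_eq_sum_even _ p m hm]
    simp only [Nat.cast_zero, mul_zero, zero_add]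
    rw [Finset.mul_sum, Finset.mul_sum, ← Finset.sum_sub_distrib, Finset.mul_sum]
    refine Finset.sum_congr rfl fun j hj => ?_
    rw [Finset.mem_range] at hj
    rw [hsub _ (by omega), Nat.cast_mul, Nat.cast_mul 2 (j + 1), map_mul]
    push_cast
    ring
  rw [e1] at e2 hT
  apply mul_left_cancel₀ hp0
  rcases hχ2 with h | h <;> rw [h] at e2 ⊢ <;> linarith

/-- The congruence for the product of odd numbers, from the class number formula
`h p = -∑ a, χ(a) a`. -/
theorem neg_prod_odd_eq_of_sum_quadraticChar (p n h : ℕ) [Fact p.Prime] (hn : p = 4 * n + 3)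
    (hT : (h : ℤ) * p = -∑ a : ZMod p, quadraticChar (ZMod p) a * a.val) :
    -(∏ k ∈ Finset.range (2 * n + 1), (2 * (k : ZMod p) + 1)) = (-1) ^ (n + 1 + (h + 1) / 2) := by
  have hpm : p = 2 * (2 * n + 1) + 1 := by omega
  have hneg : quadraticChar (ZMod p) (-1) = -1 := by
    rw [quadraticChar_neg_one (by rw [ZMod.ringChar_zmod_n]; omega), ZMod.card,
      ZMod.χ₄_nat_three_mod_four (by omega)]
  have hS := two_sub_quadraticChar_mul_eq p _ hpm hneg h hT
  obtain ⟨N, h1, h2⟩ := exists_sum_eq_and_prod_eq_of_sign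
    (fun j => quadraticChar (ZMod p) ((j + 1 : ℕ) : ZMod p)) (2 * n + 1) (fun j hj => by
      apply quadraticChar_dichotomy
      rw [Ne, ZMod.natCast_eq_zero_iff]
      intro hd
      have := Nat.le_of_dvd (by omega) hd
      omega)
  rw [h1, quadraticChar_two_eq p n hn] at hS
  rw [← map_prod, ← Nat.cast_prod, Finset.prod_range_add_one_eq_factorial] at h2
  have hfac : ((2 * n + 1).factorial : ZMod p) = (-1) ^ N := by
    have h3 := factorial_sq_eq_one p (2 * n + 1) hpm ⟨n, rfl⟩
    rw [pow_two] at h3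
    have h5 := congrArg (Int.cast : ℤ → ZMod p) h2
    push_cast at h5
    rw [← h5]
    rcases mul_self_eq_one_iff.mp h3 with h4 | h4
    · rw [h4, map_one, Int.cast_one]
    · rw [h4, hneg, Int.cast_neg, Int.cast_one]
  have hpar : (-1 : ZMod p) ^ N = (-1) ^ ((h + 1) / 2) := by
    have h3 : N % 2 = ((h + 1) / 2) % 2 := by
      rcases Nat.even_or_odd n with he | ho
      · rw [Odd.neg_one_pow he.add_one] at hS
        obtain ⟨r, hr⟩ := he
        push_cast at hS
        omega
      · rw [Even.neg_one_pow ho.add_one] at hS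
        obtain ⟨r, hr⟩ := ho
        push_cast at hS
        omega
    rw [neg_one_pow_eq_pow_mod_two, h3, ← neg_one_pow_eq_pow_mod_two]
  have hw : ((p - 1).factorial : ZMod p) = -1 := ZMod.wilsons_lemma p
  rw [show p - 1 = 2 * (2 * n + 1) by omega, ← prod_odd_mul_two_pow_mul_factorial] at hw
  push_cast at hw
  rw [hfac, hpar, two_pow_half_eq p n hn] at hw
  rw [pow_add]
  rcases neg_one_pow_eq_or (ZMod p) (n + 1) with h5 | h5 <;>
  rcases neg_one_pow_eq_or (ZMod p) ((h + 1) / 2) with h6 | h6 <;>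
  rw [h5, h6] at hw ⊢ <;> first | linear_combination hw | linear_combination -hw

theorem exists_basis_one_self {R A : Type*} [CommRing R] [CommRing A] [Algebra R A] (t : A)
    (hspan : ∀ x : A, ∃ a b : R, x = algebraMap R A a + algebraMap R A b * t)
    (hind : ∀ a b : R, algebraMap R A a + algebraMap R A b * t = 0 → a = 0 ∧ b = 0) :
    ∃ b : Module.Basis (Fin 2) R A, b 0 = 1 ∧ b 1 = t := by
  have hli : LinearIndependent R ![(1 : A), t] := by
    rw [LinearIndependent.pair_iff]
    intro a b h
    refine hind a b ?_
    rw [← h, Algebra.smul_def, Algebra.smul_def, mul_one]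
  have hsp : ⊤ ≤ Submodule.span R (Set.range ![(1 : A), t]) := by
    intro x _
    obtain ⟨a, b, rfl⟩ := hspan x
    refine add_mem ?_ ?_
    · rw [Algebra.algebraMap_eq_smul_one]
      exact Submodule.smul_mem _ _ (Submodule.subset_span ⟨0, rfl⟩)
    · rw [← Algebra.smul_def]
      exact Submodule.smul_mem _ _ (Submodule.subset_span ⟨1, rfl⟩)
  exact ⟨Module.Basis.mk hli hsp, by simp, by simp⟩

theorem leftMulMatrix_of_quadratic {R A : Type*} [CommRing R] [CommRing A] [Algebra R A]
    (b : Module.Basis (Fin 2) R A) (t : A) (h0 : b 0 = 1) (h1 : b 1 = t) (c d : R)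
    (ht : t ^ 2 = algebraMap R A c * t - algebraMap R A d) (x y : R) :
    Algebra.leftMulMatrix b (algebraMap R A x + algebraMap R A y * t) =
      !![x, -(d * y); y, x + c * y] := by
  have hrepr : ∀ u v : R, b.repr (algebraMap R A u + algebraMap R A v * t) =
      Finsupp.single 0 u + Finsupp.single 1 v := by
    intro u v
    rw [Algebra.algebraMap_eq_smul_one, ← Algebra.smul_def, ← h0, ← h1, map_add, map_smul, map_smul,
      b.repr_self, b.repr_self]
    simp
  have e1 : (algebraMap R A x + algebraMap R A y * t) * t =
      algebraMap R A (-(d * y)) + algebraMap R A (x + c * y) * t := by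
    simp only [map_add, map_mul, map_neg]
    linear_combination algebraMap R A y * ht
  ext i j
  rw [Algebra.leftMulMatrix_eq_repr_mul]
  fin_cases j
  · rw [show b (⟨0, by decide⟩ : Fin 2) = 1 from h0, mul_one, hrepr]
    fin_cases i <;> simp
  · rw [show b (⟨1, by decide⟩ : Fin 2) = t from h1, e1, hrepr]
    fin_cases i <;> simp

theorem trace_of_quadratic {R A : Type*} [CommRing R] [CommRing A] [Algebra R A]
    (b : Module.Basis (Fin 2) R A) (t : A) (h0 : b 0 = 1) (h1 : b 1 = t) (c d : R)
    (ht : t ^ 2 = algebraMap R A c * t - algebraMap R A d) (x y : R) :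
    Algebra.trace R A (algebraMap R A x + algebraMap R A y * t) = 2 * x + c * y := by
  rw [Algebra.trace_eq_matrix_trace b, leftMulMatrix_of_quadratic b t h0 h1 c d ht,
    Matrix.trace_fin_two_of]
  ring

theorem norm_of_quadratic {R A : Type*} [CommRing R] [CommRing A] [Algebra R A]
    (b : Module.Basis (Fin 2) R A) (t : A) (h0 : b 0 = 1) (h1 : b 1 = t) (c d : R)
    (ht : t ^ 2 = algebraMap R A c * t - algebraMap R A d) (x y : R) :
    Algebra.norm R (algebraMap R A x + algebraMap R A y * t) = x ^ 2 + c * x * y + d * y ^ 2 := by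
  rw [Algebra.norm_eq_matrix_det b, leftMulMatrix_of_quadratic b t h0 h1 c d ht,
    Matrix.det_fin_two_of]
  ring

theorem exists_ringOfIntegers_generator (p n : ℕ) [Fact p.Prime] (hn : p = 4 * n + 3)
    (K : Type*) [Field K] [NumberField K] (α : K) (hα : α ^ 2 = -(p : K))
    (hK : ∀ x : K, ∃ a b : ℚ, x = (a : K) + (b : K) * α) :
    ∃ θ : NumberField.RingOfIntegers K, θ ^ 2 = θ - (n + 1) ∧
      (∀ x : NumberField.RingOfIntegers K, ∃ a b : ℤ, x = a + b * θ) := by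
  have hα' : α ^ 2 = algebraMap ℚ K 0 * α - algebraMap ℚ K p := by rw [hα]; simp
  have hind : ∀ a b : ℚ, algebraMap ℚ K a + algebraMap ℚ K b * α = 0 → a = 0 ∧ b = 0 := by
    intro a b h
    have h1 : algebraMap ℚ K (a ^ 2 + p * b ^ 2) = 0 := by
      simp only [map_add, map_mul, map_pow, map_natCast]
      linear_combination (algebraMap ℚ K a - algebraMap ℚ K b * α) * h
        + (algebraMap ℚ K b) ^ 2 * hα
    have h2 : a ^ 2 + p * b ^ 2 = 0 := (map_eq_zero (algebraMap ℚ K)).mp h1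
    have hp : (0 : ℚ) < p := by exact_mod_cast (Fact.out : p.Prime).pos
    have ha : a ^ 2 = 0 := by nlinarith [sq_nonneg a, sq_nonneg b]
    have hb : p * b ^ 2 = 0 := by nlinarith [sq_nonneg a, sq_nonneg b]
    exact ⟨by simpa using ha, by simpa [hp.ne'] using hb⟩
  obtain ⟨b, h0, h1⟩ := exists_basis_one_self (R := ℚ) α hK hind
  have h2 : (2 : K) ≠ 0 := two_ne_zero
  have hintegral : IsIntegral ℤ ((1 + α) / 2) := by
    refine ⟨Polynomial.X ^ 2 - Polynomial.X + Polynomial.C ((n : ℤ) + 1), by monicity!, ?_⟩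
    simp only [Polynomial.eval₂_add, Polynomial.eval₂_sub, Polynomial.eval₂_pow,
      Polynomial.eval₂_X, Polynomial.eval₂_C]
    have hp : (p : K) = 4 * n + 3 := by rw [hn]; push_cast; ring
    rw [hp] at hα
    simp
    field_simp
    linear_combination hα
  have hp : (p : K) = 4 * n + 3 := by rw [hn]; push_cast; ring
  obtain ⟨θ, hθ⟩ : ∃ θ : NumberField.RingOfIntegers K,
      algebraMap (NumberField.RingOfIntegers K) K θ = (1 + α) / 2 := ⟨⟨_, hintegral⟩, rfl⟩
  have hinj : Function.Injective (algebraMap (NumberField.RingOfIntegers K) K) :=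
    NumberField.RingOfIntegers.coe_injective
  refine ⟨θ, hinj ?_, ?_⟩
  · rw [hp] at hα
    simp only [map_pow, map_sub, map_add, map_natCast, map_one, hθ]
    field_simp
    linear_combination hα
  · intro x
    obtain ⟨u, v, huv⟩ := hK (x : K)
    have ht : ∃ t : ℤ, (t : ℚ) = 2 * u := by
      have : IsIntegral ℤ (Algebra.trace ℚ K (x : K)) := Algebra.isIntegral_trace x.isIntegral_coe
      rw [huv] at this
      have h := trace_of_quadratic b α h0 h1 0 p hα' u v
      simp only [eq_ratCast] at h
      rw [h, zero_mul, add_zero] at this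
      obtain ⟨t, ht⟩ := IsIntegrallyClosed.isIntegral_iff.mp this
      exact ⟨t, by simpa using ht⟩
    have hN : ∃ N : ℤ, (N : ℚ) = u ^ 2 + p * v ^ 2 := by
      have : IsIntegral ℤ (Algebra.norm ℚ (x : K)) := Algebra.isIntegral_norm ℚ x.isIntegral_coe
      rw [huv] at this
      have h := norm_of_quadratic b α h0 h1 0 p hα' u v
      simp only [eq_ratCast] at h
      rw [h] at this
      obtain ⟨t, ht⟩ := IsIntegrallyClosed.isIntegral_iff.mp this
      exact ⟨t, by simpa using ht⟩
    obtain ⟨t, ht⟩ := ht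
    obtain ⟨N, hN⟩ := hN
    have hs : ∃ s : ℤ, (s : ℚ) = 2 * v := by
      have hp0 : (p : ℚ) ≠ 0 := by exact_mod_cast (Fact.out : p.Prime).ne_zero
      have hsq : ((p : ℚ) * (2 * v)) ^ 2 = ((p * (4 * N - t ^ 2) : ℤ) : ℚ) := by
        push_cast
        rw [hN, ht]
        ring
      have hwi : IsIntegral ℤ ((p : ℚ) * (2 * v)) := by
        refine IsIntegral.of_pow (n := 2) two_pos ?_
        rw [hsq]
        exact isIntegral_algebraMap (R := ℤ) (A := ℚ)
      obtain ⟨w, hw⟩ := IsIntegrallyClosed.isIntegral_iff.mp hwi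
      rw [eq_intCast] at hw
      have hdvd : (p : ℤ) ∣ w ^ 2 := ⟨4 * N - t ^ 2, by
        have : (w : ℚ) ^ 2 = ((p * (4 * N - t ^ 2) : ℤ) : ℚ) := by rw [hw, hsq]
        exact_mod_cast this⟩
      obtain ⟨s, rfl⟩ := (Nat.prime_iff_prime_int.mp Fact.out).dvd_of_dvd_pow hdvd
      refine ⟨s, mul_left_cancel₀ hp0 ?_⟩
      rw [← hw]
      push_cast
      rfl
    obtain ⟨s, hs⟩ := hs
    have hpar : Even (t - s) := by
      have h3 : t ^ 2 + p * s ^ 2 = 4 * N := by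
        have : (t : ℚ) ^ 2 + p * s ^ 2 = 4 * N := by rw [ht, hs, hN]; ring
        exact_mod_cast this
      have h4 : Even (t ^ 2 + p * s ^ 2) := by rw [h3]; exact ⟨2 * N, by ring⟩
      have h5 : ¬ Even (p : ℤ) := by
        rw [Int.not_even_iff]; omega
      simp only [Int.even_add, Int.even_mul, Int.even_pow, Int.even_sub] at *
      tauto
    obtain ⟨r, hr⟩ := hpar
    refine ⟨r, s, ?_⟩
    have hr' : (t : ℚ) - s = r + r := by exact_mod_cast hr
    have hu : u = r + s / 2 := by linarith
    have hv : v = s / 2 := by linarith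
    apply hinj
    simp only [map_add, map_mul, map_intCast, hθ]
    refine huv.trans ?_
    rw [hu, hv]
    push_cast
    ring

theorem sq_add_of_generator {R : Type*} [CommRing R] {θ : R} {n : ℕ} (hθ : θ ^ 2 = θ - (n + 1))
    (a b : R) : (a + b * θ) * (a + b * (1 - θ)) = a ^ 2 + a * b + (n + 1) * b ^ 2 := by
  linear_combination -b ^ 2 * hθ

/-- For `p ≡ 3 (mod 4)`, the ring of integers of `ℚ(√-p)` has a `ℤ`-basis `1, θ`
with `θ = (1 + √-p) / 2`. -/
theorem exists_basis_ringOfIntegers (p n : ℕ) [Fact p.Prime] (hn : p = 4 * n + 3)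
    (K : Type*) [Field K] [NumberField K] (α : K) (hα : α ^ 2 = -(p : K))
    (hK : ∀ x : K, ∃ a b : ℚ, x = (a : K) + (b : K) * α) :
    ∃ b : Module.Basis (Fin 2) ℤ (NumberField.RingOfIntegers K),
      b 0 = 1 ∧ (b 1) ^ 2 = b 1 - (n + 1) := by
  obtain ⟨θ, hθ, hspan⟩ := exists_ringOfIntegers_generator p n hn K α hα hK
  obtain ⟨b, h0, h1⟩ := exists_basis_one_self (R := ℤ) θ (by simpa using hspan) (by
    intro a b h
    simp only [algebraMap_int_eq, eq_intCast] at h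
    have h1 := sq_add_of_generator hθ (a : NumberField.RingOfIntegers K) b
    rw [h, zero_mul] at h1
    have h2 : a ^ 2 + a * b + (n + 1) * b ^ 2 = 0 := by exact_mod_cast h1.symm
    have hb : b = 0 := by
      have hn0 : (0 : ℤ) ≤ n * b ^ 2 := by positivity
      have : b ^ 2 = 0 := by nlinarith [sq_nonneg b, sq_nonneg (2 * a + b)]
      simpa using this
    subst hb
    exact ⟨by simpa using h2, rfl⟩)
  exact ⟨b, h0, by rw [h1, hθ]⟩

section ImaginaryQuadratic

open NumberField NumberField.InfinitePlace

variable {K : Type*} [Field K] [NumberField K]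

omit [NumberField K] in
theorem repr_of_basis (b : Module.Basis (Fin 2) ℤ (𝓞 K)) (h0 : b 0 = 1) (x : 𝓞 K) :
    ∃ u v : ℤ, x = u + v * b 1 := by
  refine ⟨b.repr x 0, b.repr x 1, ?_⟩
  conv_lhs => rw [← b.sum_repr x]
  simp [Fin.sum_univ_two, h0]

theorem discr_eq_of_basis (n : ℕ) (b : Module.Basis (Fin 2) ℤ (𝓞 K)) (h0 : b 0 = 1)
    (h1 : (b 1) ^ 2 = b 1 - (n + 1)) : discr K = -(4 * n + 3) := by
  have ht : (b 1) ^ 2 = algebraMap ℤ (𝓞 K) 1 * b 1 - algebraMap ℤ (𝓞 K) (n + 1) := by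
    simpa using h1
  have htr := trace_of_quadratic b (b 1) h0 rfl 1 (n + 1) ht
  have e1 := htr 1 0
  have e2 := htr 0 1
  have e3 := htr (-(n + 1)) 1
  have h3 : algebraMap ℤ (𝓞 K) (-(n + 1)) + algebraMap ℤ (𝓞 K) 1 * b 1 = b 1 * b 1 := by
    rw [← sq, h1]; simp; ring
  rw [h3] at e3
  simp only [map_one, map_zero, zero_mul, add_zero, zero_add, one_mul] at e1 e2 e3
  rw [← discr_eq_discr K b, Algebra.discr_def, Matrix.det_fin_two]
  simp only [Algebra.traceMatrix_apply, Algebra.traceForm_apply, h0, one_mul, mul_one, e1, e2, e3]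
  ring

theorem isEmpty_isReal_of_sq_eq (n : ℕ) (θ : 𝓞 K) (h1 : θ ^ 2 = θ - (n + 1)) :
    IsEmpty {w : InfinitePlace K // w.IsReal} := by
  refine ⟨fun ⟨w, hw⟩ => ?_⟩
  rw [InfinitePlace.isReal_iff] at hw
  have h2 := congrArg (fun x => hw.embedding (algebraMap (𝓞 K) K x)) h1
  simp only [map_pow, map_sub, map_add, map_natCast, map_one] at h2
  have hn0 : (0 : ℝ) ≤ n := by positivity
  nlinarith [sq_nonneg (2 * hw.embedding (algebraMap (𝓞 K) K θ) - 1)]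

omit [NumberField K] in
theorem norm_of_basis (n : ℕ) (b : Module.Basis (Fin 2) ℤ (𝓞 K)) (h0 : b 0 = 1)
    (h1 : (b 1) ^ 2 = b 1 - (n + 1)) (u v : ℤ) :
    Algebra.norm ℤ ((u : 𝓞 K) + v * b 1) = u ^ 2 + u * v + (n + 1) * v ^ 2 := by
  have ht : (b 1) ^ 2 = algebraMap ℤ (𝓞 K) 1 * b 1 - algebraMap ℤ (𝓞 K) (n + 1) := by
    simpa using h1
  simpa using norm_of_quadratic b (b 1) h0 rfl 1 (n + 1) ht u v

omit [NumberField K] in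
theorem units_eq_one_or_neg_one (n : ℕ) (hn : 0 < n) (b : Module.Basis (Fin 2) ℤ (𝓞 K))
    (h0 : b 0 = 1) (h1 : (b 1) ^ 2 = b 1 - (n + 1)) (x : (𝓞 K)ˣ) : x = 1 ∨ x = -1 := by
  obtain ⟨u, v, huv⟩ := repr_of_basis b h0 (x : 𝓞 K)
  have hN : IsUnit (Algebra.norm ℤ (x : 𝓞 K)) := x.isUnit.map _
  rw [huv, norm_of_basis n b h0 h1, Int.isUnit_iff] at hN
  have hn1 : (1 : ℤ) ≤ n := by exact_mod_cast hn
  have hv : v = 0 := by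
    by_contra hv
    have hv1 : 1 ≤ v ^ 2 := by
      have : 0 < v ^ 2 := by positivity
      omega
    rcases hN with hN | hN <;> nlinarith [sq_nonneg (2 * u + v)]
  subst hv
  have hu : u = 1 ∨ u = -1 := by
    rw [← sq_eq_one_iff]
    rcases hN with hN | hN <;> nlinarith [sq_nonneg u]
  rcases hu with rfl | rfl
  · left; ext; simp [huv]
  · right; ext; simp [huv]

/-- The residue of the Dedekind zeta function of `ℚ(√-p)` is `π h / √p`. -/
theorem dedekindZeta_residue_of_basis (p n : ℕ) (hp : p = 4 * n + 3) (hn : 0 < n)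
    (b : Module.Basis (Fin 2) ℤ (𝓞 K)) (h0 : b 0 = 1) (h1 : (b 1) ^ 2 = b 1 - (n + 1)) :
    dedekindZeta_residue K = Real.pi * classNumber K / Real.sqrt p := by
  have hreal : nrRealPlaces K = 0 := by
    have := isEmpty_isReal_of_sq_eq n (b 1) h1
    classical exact Fintype.card_eq_zero_iff.mpr this
  have hfin : Module.finrank ℚ K = 2 := by
    rw [← RingOfIntegers.rank K, Module.finrank_eq_card_basis b, Fintype.card_fin]
  have hcomplex : nrComplexPlaces K = 1 := by
    have := InfinitePlace.card_add_two_mul_card_eq_rank K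
    omega
  have hrank : Units.rank K = 0 := by
    have := InfinitePlace.card_eq_nrRealPlaces_add_nrComplexPlaces K
    rw [Units.rank, this, hreal, hcomplex]
  have hreg : Units.regulator K = 1 := by
    have hcard : Fintype.card (InfinitePlace K) = 1 := by
      rw [InfinitePlace.card_eq_nrRealPlaces_add_nrComplexPlaces K, hreal, hcomplex]
    have : IsEmpty {w : InfinitePlace K // w ≠ Units.dirichletUnitTheorem.w₀} :=
      ⟨fun w => w.2 (Fintype.card_le_one_iff.mp hcard.le _ _)⟩
    rw [Units.regulator_eq_det', ← abs_one]
    classical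
    exact congrArg abs (Matrix.det_eq_one_of_card_eq_zero (Fintype.card_eq_zero_iff.mpr this))
  have htors : Units.torsionOrder K = 2 := by
    refine le_antisymm ?_ (Nat.le_of_dvd (Units.torsionOrder_pos K)
      (Units.even_torsionOrder K).two_dvd)
    have hsub : (Units.torsion K : Set (𝓞 K)ˣ) ⊆ ({1, -1} : Set (𝓞 K)ˣ) := fun x _ =>
      units_eq_one_or_neg_one n hn b h0 h1 x
    calc Units.torsionOrder K = (Units.torsion K : Set (𝓞 K)ˣ).ncard := rfl
      _ ≤ ({1, -1} : Set (𝓞 K)ˣ).ncard := Set.ncard_le_ncard hsub (by simp)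
      _ ≤ 2 := (Set.ncard_insert_le _ _).trans (by simp)
  rw [dedekindZeta_residue_def, hreal, hcomplex, hreg, htors, discr_eq_of_basis n b h0 h1]
  have : |((-(4 * n + 3) : ℤ) : ℝ)| = p := by
    rw [hp]; push_cast; rw [abs_neg, abs_of_nonneg (by positivity)]
  rw [this]
  field_simp
  ring

end ImaginaryQuadratic

section IdealCount

open Ideal

variable {R : Type*} [CommRing R] [IsDedekindDomain R] [Module.Free ℤ R]

theorem isCoprime_of_absNorm_coprime {I J : Ideal R}
    (h : (absNorm I).Coprime (absNorm J)) : IsCoprime I J := by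
  rw [Ideal.isCoprime_iff_exists]
  obtain ⟨u, v, huv⟩ := Nat.isCoprime_iff_coprime.mpr h
  refine ⟨u * (absNorm I : R), I.mul_mem_left _ (absNorm_mem I), v * (absNorm J : R),
    J.mul_mem_left _ (absNorm_mem J), ?_⟩
  exact_mod_cast congrArg (Int.cast (R := R)) huv

/-- The number of ideals of given norm is multiplicative. -/
theorem card_absNorm_mul_of_coprime [Module.Finite ℤ R] {m n : ℕ} (hm : m ≠ 0) (hn : n ≠ 0)
    (h : m.Coprime n) :
    Nat.card {I : Ideal R // absNorm I = m * n} =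
      Nat.card {I : Ideal R // absNorm I = m} * Nat.card {I : Ideal R // absNorm I = n} := by
  rw [← Nat.card_prod]
  symm
  refine Nat.card_congr (Equiv.ofBijective
    (fun IJ => ⟨IJ.1.1 * IJ.2.1, by rw [map_mul, IJ.1.2, IJ.2.2]⟩) ⟨?_, ?_⟩)
  · have key : ∀ I I' J J' : Ideal R, absNorm I = m → absNorm J' = n → I * J = I' * J' →
        I' ≤ I := by
      intro I I' J J' hI hJ' he
      have hc : IsCoprime I J' := isCoprime_of_absNorm_coprime (by rw [hI, hJ']; exact h)
      exact Ideal.le_of_dvd (hc.dvd_of_dvd_mul_right ⟨J, he.symm⟩)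
    rintro ⟨⟨I, hI⟩, ⟨J, hJ⟩⟩ ⟨⟨I', hI'⟩, ⟨J', hJ'⟩⟩ he
    have he' : I * J = I' * J' := congrArg Subtype.val he
    have e1 : I = I' := le_antisymm (key I' I J' J hI' hJ he'.symm) (key I I' J J' hI hJ' he')
    have hI0 : I ≠ ⊥ := by
      rintro rfl
      exact hm (by rw [← hI, absNorm_bot])
    subst e1
    have e2 : J = J' := mul_left_cancel₀ hI0 he'
    subst e2
    rfl
  · rintro ⟨I, hI⟩
    have hmn : ((m : R) * n) ∈ I := by
      have := absNorm_mem I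
      rwa [hI, Nat.cast_mul] at this
    obtain ⟨u, v, huv⟩ := Nat.isCoprime_iff_coprime.mpr h
    have huv' : (u : R) * m + v * n = 1 := by exact_mod_cast congrArg (Int.cast (R := R)) huv
    have hprod : (I ⊔ span {(m : R)}) * (I ⊔ span {(n : R)}) = I := by
      apply le_antisymm
      · rw [Ideal.mul_le]
        intro x hx y hy
        rw [Submodule.mem_sup] at hx hy
        obtain ⟨a, ha, b, hb, rfl⟩ := hx
        obtain ⟨c, hc, d, hd, rfl⟩ := hy
        obtain ⟨b, rfl⟩ := Ideal.mem_span_singleton'.mp hb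
        obtain ⟨d, rfl⟩ := Ideal.mem_span_singleton'.mp hd
        have e : (a + b * m) * (c + d * n) = (c + d * n) * a + b * m * c + b * d * (m * n) := by
          ring
        rw [e]
        exact add_mem (add_mem (I.mul_mem_left _ ha) (I.mul_mem_left _ hc)) (I.mul_mem_left _ hmn)
      · intro x hx
        have e : x = u * ((m : R) * x) + v * (x * n) := by linear_combination (-x) * huv'
        rw [e]
        refine add_mem (Ideal.mul_mem_left _ _ (Ideal.mul_mem_mul ?_ ?_))
          (Ideal.mul_mem_left _ _ (Ideal.mul_mem_mul ?_ ?_))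
        · exact Ideal.mem_sup_right (Ideal.mem_span_singleton_self _)
        · exact Ideal.mem_sup_left hx
        · exact Ideal.mem_sup_left hx
        · exact Ideal.mem_sup_right (Ideal.mem_span_singleton_self _)
    have hN := congrArg absNorm hprod
    rw [map_mul, hI] at hN
    have hdvd : ∀ a b : ℕ, a.Coprime b → absNorm (I ⊔ span {(a : R)}) ∣ a * b →
        absNorm (I ⊔ span {(a : R)}) ∣ a := by
      intro a b hab hd
      refine Nat.Coprime.dvd_of_dvd_mul_right ?_ hd
      have h1 : absNorm (I ⊔ span {(a : R)}) ∣ a ^ Module.finrank ℤ R := by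
        rw [← absNorm_span_natCast]
        exact absNorm_dvd_absNorm_of_le le_sup_right
      exact Nat.Coprime.coprime_dvd_left h1 (hab.pow_left _)
    have d1 := hdvd m n h ⟨_, hN.symm⟩
    have d2 := hdvd n m h.symm ⟨absNorm (I ⊔ span {(m : R)}), by rw [mul_comm n m, ← hN, mul_comm]⟩
    have l1 := Nat.le_of_dvd (Nat.pos_of_ne_zero hm) d1
    have l2 := Nat.le_of_dvd (Nat.pos_of_ne_zero hn) d2
    have e1 : absNorm (I ⊔ span {(m : R)}) = m := by
      refine le_antisymm l1 ?_
      by_contra hlt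
      have := Nat.mul_lt_mul_of_lt_of_le (not_le.mp hlt) l2 (Nat.pos_of_ne_zero hn)
      omega
    rw [e1] at hN
    have e2 := Nat.eq_of_mul_eq_mul_left (Nat.pos_of_ne_zero hm) hN
    exact ⟨(⟨_, e1⟩, ⟨_, e2⟩), Subtype.ext hprod⟩

/-- An ideal of norm `ℓ ^ (k + 1)` is divisible by some maximal ideal containing `ℓ`. -/
theorem exists_isMaximal_mul_of_absNorm_eq_pow {ℓ k : ℕ} (hℓ : ℓ.Prime) {I : Ideal R}
    (hI : absNorm I = ℓ ^ (k + 1)) :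
    ∃ M J : Ideal R, M.IsMaximal ∧ (ℓ : R) ∈ M ∧ I = M * J := by
  have htop : I ≠ ⊤ := by
    rintro rfl
    rw [absNorm_top] at hI
    exact (Nat.one_lt_pow (Nat.succ_ne_zero k) hℓ.one_lt).ne hI
  obtain ⟨M, hM, hIM⟩ := Ideal.exists_le_maximal I htop
  obtain ⟨J, hJ⟩ := Ideal.dvd_iff_le.mpr hIM
  refine ⟨M, J, hM, ?_, hJ⟩
  have : (ℓ : R) ^ (k + 1) ∈ M := by
    have := hIM (absNorm_mem I)
    rwa [hI, Nat.cast_pow] at this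
  exact hM.isPrime.mem_of_pow_mem _ this

/-- If `ℓ` has a single prime `P` above it, the ideals of norm `ℓ ^ k` are powers of `P`. -/
theorem exists_eq_pow_of_absNorm_eq_pow {ℓ e : ℕ} (hℓ : ℓ.Prime) (he : 0 < e) {P : Ideal R}
    (hP : absNorm P = ℓ ^ e) (huniq : ∀ M : Ideal R, M.IsMaximal → (ℓ : R) ∈ M → M = P) :
    ∀ (k : ℕ) (I : Ideal R), absNorm I = ℓ ^ k → ∃ i, k = e * i ∧ I = P ^ i := by
  intro k
  induction k using Nat.strong_induction_on with
  | _ k ih =>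
    intro I hI
    rcases k with _ | k
    · exact ⟨0, rfl, by rw [pow_zero, one_eq_top, ← absNorm_eq_one_iff, hI, pow_zero]⟩
    · obtain ⟨M, J, hM, hℓM, rfl⟩ := exists_isMaximal_mul_of_absNorm_eq_pow hℓ hI
      obtain rfl := huniq M hM hℓM
      rw [map_mul, hP] at hI
      have hle : e ≤ k + 1 := (Nat.pow_dvd_pow_iff_le_right hℓ.one_lt).mp ⟨_, hI.symm⟩
      have hJ : absNorm J = ℓ ^ (k + 1 - e) := by
        refine Nat.eq_of_mul_eq_mul_left (pow_pos hℓ.pos e) ?_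
        rw [hI, ← pow_add, Nat.add_sub_cancel' hle]
      obtain ⟨i, hi, rfl⟩ := ih _ (by omega) J hJ
      refine ⟨i + 1, ?_, (pow_succ' _ _).symm⟩
      rw [mul_add, mul_one, ← hi]
      omega

theorem card_absNorm_eq_pow_of_unique [Module.Finite ℤ R] {ℓ e : ℕ} (hℓ : ℓ.Prime)
    (he : 0 < e) {P : Ideal R} (hP : absNorm P = ℓ ^ e)
    (huniq : ∀ M : Ideal R, M.IsMaximal → (ℓ : R) ∈ M → M = P) (k : ℕ) :
    Nat.card {I : Ideal R // absNorm I = ℓ ^ k} = if e ∣ k then 1 else 0 := by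
  have key := exists_eq_pow_of_absNorm_eq_pow hℓ he hP huniq k
  split_ifs with hk
  · obtain ⟨j, rfl⟩ := hk
    rw [Nat.card_eq_one_iff_unique]
    refine ⟨⟨fun ⟨I, hI⟩ ⟨I', hI'⟩ => ?_⟩, ⟨⟨P ^ j, by rw [map_pow, hP, ← pow_mul]⟩⟩⟩
    obtain ⟨i, hi, rfl⟩ := key I hI
    obtain ⟨i', hi', rfl⟩ := key I' hI'
    have : i = i' := Nat.eq_of_mul_eq_mul_left he (hi.symm.trans hi')
    subst this
    rfl
  · have : IsEmpty {I : Ideal R // absNorm I = ℓ ^ k} :=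
      ⟨fun ⟨I, hI⟩ => by
        obtain ⟨i, hi, -⟩ := key I hI
        exact hk ⟨i, hi⟩⟩
    exact Nat.card_of_isEmpty

/-- If `ℓ` has exactly two primes `P`, `Q` above it, both of norm `ℓ`, the ideals of norm `ℓ ^ k`
are the products `P ^ i * Q ^ j` with `i + j = k`. -/
theorem exists_eq_pow_mul_pow_of_absNorm_eq_pow {ℓ : ℕ} (hℓ : ℓ.Prime) {P Q : Ideal R}
    (hP : absNorm P = ℓ) (hQ : absNorm Q = ℓ)
    (huniq : ∀ M : Ideal R, M.IsMaximal → (ℓ : R) ∈ M → M = P ∨ M = Q) :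
    ∀ (k : ℕ) (I : Ideal R), absNorm I = ℓ ^ k → ∃ i j, i + j = k ∧ I = P ^ i * Q ^ j := by
  intro k
  induction k with
  | zero =>
    intro I hI
    exact ⟨0, 0, rfl, by
      rw [pow_zero, pow_zero, one_mul, one_eq_top, ← absNorm_eq_one_iff, hI, pow_zero]⟩
  | succ k ih =>
    intro I hI
    obtain ⟨M, J, hM, hℓM, rfl⟩ := exists_isMaximal_mul_of_absNorm_eq_pow hℓ hI
    have hMP := huniq M hM hℓM
    have hMN : absNorm M = ℓ := by rcases hMP with rfl | rfl <;> assumption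
    have hJ : absNorm J = ℓ ^ k := by
      rw [map_mul, hMN, pow_succ'] at hI
      exact Nat.eq_of_mul_eq_mul_left hℓ.pos hI
    obtain ⟨i, j, hij, rfl⟩ := ih J hJ
    rcases hMP with rfl | rfl
    · exact ⟨i + 1, j, by omega, by ring⟩
    · exact ⟨i, j + 1, by omega, by ring⟩

theorem card_absNorm_eq_pow_of_pair [Module.Finite ℤ R] {ℓ : ℕ} (hℓ : ℓ.Prime) {P Q : Ideal R}
    (hP : absNorm P = ℓ) (hQ : absNorm Q = ℓ) (hPQ : P ≠ Q)
    (huniq : ∀ M : Ideal R, M.IsMaximal → (ℓ : R) ∈ M → M = P ∨ M = Q) (k : ℕ) :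
    Nat.card {I : Ideal R // absNorm I = ℓ ^ k} = k + 1 := by
  have hPp : P.IsPrime := isPrime_of_irreducible_absNorm (by rwa [hP])
  have hQp : Q.IsPrime := isPrime_of_irreducible_absNorm (by rwa [hQ])
  have hP0 : P ≠ ⊥ := by
    rintro rfl
    rw [absNorm_bot] at hP
    exact hℓ.ne_zero hP.symm
  have hinj : ∀ i j i' j' : ℕ, i + j = i' + j' → P ^ i * Q ^ j = P ^ i' * Q ^ j' → i' ≤ i := by
    intro i j i' j' hs he
    by_contra hlt
    obtain ⟨d, rfl⟩ := Nat.exists_eq_add_of_lt (not_le.mp hlt)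
    have h1 : Q ^ j = P * (P ^ d * Q ^ j') := by
      refine mul_left_cancel₀ (pow_ne_zero i hP0) ?_
      rw [he]
      ring
    have h2 : P ∣ Q ^ j := ⟨_, h1⟩
    have h3 : Q ≤ P := hPp.le_of_pow_le (Ideal.le_of_dvd h2)
    have hQ0 : Q ≠ ⊥ := by
      rintro rfl
      rw [absNorm_bot] at hQ
      exact hℓ.ne_zero hQ.symm
    exact hPQ ((hQp.isMaximal hQ0).eq_of_le hPp.ne_top h3).symm
  rw [← Nat.card_fin (k + 1)]
  symm
  refine Nat.card_congr (Equiv.ofBijective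
    (fun i => ⟨P ^ (i : ℕ) * Q ^ (k - i : ℕ), ?_⟩) ⟨?_, ?_⟩)
  · rw [map_mul, map_pow, map_pow, hP, hQ, ← pow_add]
    congr 1
    omega
  · intro i i' h
    have h' : P ^ (i : ℕ) * Q ^ (k - i : ℕ) = P ^ (i' : ℕ) * Q ^ (k - i' : ℕ) :=
      congrArg Subtype.val h
    exact Fin.ext (le_antisymm (hinj _ _ _ _ (by omega) h'.symm) (hinj _ _ _ _ (by omega) h'))
  · rintro ⟨I, hI⟩
    obtain ⟨i, j, hij, rfl⟩ := exists_eq_pow_mul_pow_of_absNorm_eq_pow hℓ hP hQ huniq k I hI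
    refine ⟨⟨i, by omega⟩, Subtype.ext ?_⟩
    simp only
    congr 2
    omega

end IdealCount

theorem quadraticChar_neg_prime_eq (p n ℓ : ℕ) [Fact p.Prime] [Fact ℓ.Prime] (hp : p = 4 * n + 3)
    (h2 : ℓ ≠ 2) (hne : ℓ ≠ p) :
    quadraticChar (ZMod p) ℓ = quadraticChar (ZMod ℓ) (-(p : ZMod ℓ)) := by
  have hp2 : p ≠ 2 := by omega
  rw [quadraticChar_odd_prime (by rwa [ZMod.ringChar_zmod_n]) h2
      (by rw [ZMod.ringChar_zmod_n]; exact hne.symm),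
    ZMod.card, ZMod.χ₄_nat_three_mod_four (by omega)]
  simp

section PrimeDecomposition

open NumberField Ideal

variable {K : Type*} [Field K] [NumberField K]

theorem exists_root_of_quadraticChar_eq_one (p n ℓ : ℕ) [Fact p.Prime] [Fact ℓ.Prime]
    (hp : p = 4 * n + 3) (h : quadraticChar (ZMod p) ℓ = 1) :
    ∃ b : ℤ, (ℓ : ℤ) ∣ b ^ 2 - b + (n + 1) ∧ ¬ (ℓ : ℤ) ∣ 2 * b - 1 := by
  have hℓ : ℓ.Prime := Fact.out
  rcases hℓ.eq_two_or_odd' with rfl | hodd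
  · refine ⟨0, ?_, by decide⟩
    rw [Nat.cast_ofNat, quadraticChar_two_eq p n hp, neg_one_pow_eq_one_iff_even (by decide)] at h
    obtain ⟨m, hm⟩ := h
    exact ⟨m, by push_cast; omega⟩
  · have h2 : ℓ ≠ 2 := by rintro rfl; revert hodd; decide
    have hrec := quadraticChar_neg_prime_eq p n ℓ hp h2 (by
      rintro rfl
      simp at h)
    rw [hrec] at h
    have h20 : (2 : ZMod ℓ) ≠ 0 := by
      intro h0
      have : (ℓ : ℕ) ∣ 2 := (ZMod.natCast_eq_zero_iff 2 ℓ).mp (by exact_mod_cast h0)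
      exact h2 ((Nat.prime_dvd_prime_iff_eq hℓ Nat.prime_two).mp this)
    have hp0 : (-(p : ZMod ℓ)) ≠ 0 := by
      intro h0
      rw [h0] at h
      simp at h
    obtain ⟨c, hc⟩ := (quadraticChar_one_iff_isSquare hp0).mp h
    obtain ⟨b, hb⟩ := ZMod.intCast_surjective ((1 + c) / 2)
    have hb' : 2 * (b : ZMod ℓ) = 1 + c := by rw [hb]; field_simp
    refine ⟨b, ?_, ?_⟩
    · rw [← ZMod.intCast_zmod_eq_zero_iff_dvd]
      push_cast
      have h4 : (2 : ZMod ℓ) ^ 2 * ((b : ZMod ℓ) ^ 2 - b + (n + 1)) = 0 := by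
        have hpn : (p : ZMod ℓ) = 4 * n + 3 := by rw [hp]; push_cast; ring
        rw [hpn] at hc
        linear_combination (2 * (b : ZMod ℓ) - 1 + c) * hb' - hc
      exact (mul_eq_zero.mp h4).resolve_left (pow_ne_zero _ h20)
    · rw [← ZMod.intCast_zmod_eq_zero_iff_dvd]
      push_cast
      intro h0
      apply hp0
      have : c = 0 := by linear_combination h0 - hb'
      rw [hc, this, mul_zero]

theorem not_dvd_of_quadraticChar_eq_neg_one (p n ℓ : ℕ) [Fact p.Prime] [Fact ℓ.Prime]
    (hp : p = 4 * n + 3) (h : quadraticChar (ZMod p) ℓ = -1) (b : ℤ) :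
    ¬ (ℓ : ℤ) ∣ b ^ 2 - b + (n + 1) := by
  intro hb
  have hℓ : ℓ.Prime := Fact.out
  rcases hℓ.eq_two_or_odd' with rfl | hodd
  · rw [Nat.cast_ofNat, quadraticChar_two_eq p n hp, neg_one_pow_eq_neg_one_iff_odd (by decide)]
      at h
    have h1 : Even (b * (b - 1)) := Int.even_mul_pred_self b
    have h2 : Even (b ^ 2 - b + (n + 1)) := (even_iff_two_dvd).mpr (by exact_mod_cast hb)
    have h3 : Odd ((n : ℤ) + 1) := by exact_mod_cast h
    have h4 : (b : ℤ) ^ 2 - b + (n + 1) = b * (b - 1) + (n + 1) := by ring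
    rw [h4] at h2
    exact Int.not_even_iff_odd.mpr (h1.add_odd h3) h2
  · have h2 : ℓ ≠ 2 := by rintro rfl; revert hodd; decide
    have hrec := quadraticChar_neg_prime_eq p n ℓ hp h2 (by
      rintro rfl
      simp at h)
    rw [hrec] at h
    refine (quadraticChar_neg_one_iff_not_isSquare.mp h) ⟨2 * b - 1, ?_⟩
    rw [← ZMod.intCast_zmod_eq_zero_iff_dvd] at hb
    push_cast at hb
    rw [hp]
    push_cast
    linear_combination -4 * hb

theorem prime_natCast_of_no_root (n ℓ : ℕ) [Fact ℓ.Prime]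
    (b : Module.Basis (Fin 2) ℤ (𝓞 K)) (h0 : b 0 = 1) (h1 : (b 1) ^ 2 = b 1 - (n + 1))
    (h : ∀ a : ℤ, ¬ (ℓ : ℤ) ∣ a ^ 2 - a + (n + 1)) : Prime (ℓ : 𝓞 K) := by
  have hℓ : ℓ.Prime := Fact.out
  have hℓ' : Prime (ℓ : ℤ) := Nat.prime_iff_prime_int.mp hℓ
  have hnorm : ∀ x : 𝓞 K, (ℓ : ℤ) ∣ Algebra.norm ℤ x → (ℓ : 𝓞 K) ∣ x := by
    intro x hx
    obtain ⟨u, v, rfl⟩ := repr_of_basis b h0 x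
    rw [norm_of_basis n b h0 h1] at hx
    have hv : (ℓ : ℤ) ∣ v := by
      by_contra hv
      have hc : IsCoprime v (ℓ : ℤ) := (hℓ'.coprime_iff_not_dvd.mpr hv).symm
      obtain ⟨w, z, hw⟩ := hc
      refine h (-(u * w)) ?_
      have e : (-(u * w)) ^ 2 - -(u * w) + (n + 1) =
          w ^ 2 * (u ^ 2 + u * v + (n + 1) * v ^ 2)
            + ℓ * (z * (u * w + (n + 1) * (1 + w * v))) := by
        linear_combination (-u * w - (n + 1) * (1 + w * v)) * hw
      rw [e]
      exact dvd_add (hx.mul_left _) (dvd_mul_right _ _)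
    have hu : (ℓ : ℤ) ∣ u := by
      refine hℓ'.dvd_of_dvd_pow (n := 2) ?_
      have e : u ^ 2 = (u ^ 2 + u * v + (n + 1) * v ^ 2) - v * (u + (n + 1) * v) := by ring
      rw [e]
      exact dvd_sub hx (hv.mul_right _)
    obtain ⟨u', rfl⟩ := hu
    obtain ⟨v', rfl⟩ := hv
    exact ⟨u' + v' * b 1, by push_cast; ring⟩
  refine ⟨by exact_mod_cast hℓ.ne_zero, ?_, ?_⟩
  · intro hunit
    have h2 : IsUnit (Algebra.norm ℤ (ℓ : 𝓞 K)) := hunit.map _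
    have h3 := norm_of_basis n b h0 h1 ℓ 0
    simp only [Int.cast_natCast, Int.cast_zero, zero_mul, add_zero, mul_zero] at h3
    rw [h3] at h2
    exact hℓ'.not_isUnit (isUnit_of_dvd_unit ⟨ℓ, by ring⟩ h2)
  · intro x y hxy
    have h2 : (ℓ : ℤ) ∣ Algebra.norm ℤ x * Algebra.norm ℤ y := by
      obtain ⟨z, hz⟩ := hxy
      rw [← map_mul, hz, map_mul]
      have h3 := norm_of_basis n b h0 h1 ℓ 0
      simp only [Int.cast_natCast, Int.cast_zero, zero_mul, add_zero, mul_zero] at h3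
      rw [h3]
      exact ⟨ℓ * Algebra.norm ℤ z, by ring⟩
    exact (hℓ'.dvd_or_dvd h2).imp (hnorm x) (hnorm y)

omit [NumberField K] in
theorem finrank_of_basis (b : Module.Basis (Fin 2) ℤ (𝓞 K)) : Module.finrank ℤ (𝓞 K) = 2 := by
  rw [Module.finrank_eq_card_basis b, Fintype.card_fin]

theorem card_absNorm_eq_pow_inert (n ℓ : ℕ) [Fact ℓ.Prime]
    (b : Module.Basis (Fin 2) ℤ (𝓞 K)) (h0 : b 0 = 1) (h1 : (b 1) ^ 2 = b 1 - (n + 1))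
    (h : ∀ a : ℤ, ¬ (ℓ : ℤ) ∣ a ^ 2 - a + (n + 1)) (k : ℕ) :
    Nat.card {I : Ideal (𝓞 K) // absNorm I = ℓ ^ k} = if 2 ∣ k then 1 else 0 := by
  have hℓ : ℓ.Prime := Fact.out
  have hprime := prime_natCast_of_no_root n ℓ b h0 h1 h
  refine card_absNorm_eq_pow_of_unique hℓ two_pos (P := span {(ℓ : 𝓞 K)}) ?_ ?_ k
  · rw [absNorm_span_natCast, finrank_of_basis b]
  · intro M hM hℓM
    have hP : (span {(ℓ : 𝓞 K)}).IsPrime := (span_singleton_prime hprime.ne_zero).mpr hprime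
    have hP0 : span {(ℓ : 𝓞 K)} ≠ ⊥ := by
      simpa using hprime.ne_zero
    exact ((hP.isMaximal hP0).eq_of_le hM.ne_top
      ((span_singleton_le_iff_mem _).mpr hℓM)).symm

theorem card_absNorm_eq_pow_ramified (p n : ℕ) [Fact p.Prime] (hp : p = 4 * n + 3)
    (b : Module.Basis (Fin 2) ℤ (𝓞 K)) (h1 : (b 1) ^ 2 = b 1 - (n + 1)) (k : ℕ) :
    Nat.card {I : Ideal (𝓞 K) // absNorm I = p ^ k} = 1 := by
  have hpp : p.Prime := Fact.out
  have hsq : (2 * b 1 - 1) ^ 2 = -(p : 𝓞 K) := by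
    rw [hp]
    push_cast
    linear_combination 4 * h1
  have hP : absNorm (span {2 * b 1 - 1}) = p := by
    have h2 : absNorm (span {2 * b 1 - 1}) ^ 2 = p ^ 2 := by
      rw [← map_pow, span_singleton_pow, hsq, span_singleton_neg, absNorm_span_natCast,
        finrank_of_basis b]
    exact Nat.pow_left_injective two_ne_zero h2
  have hPp : (span {2 * b 1 - 1}).IsPrime := isPrime_of_irreducible_absNorm (by rwa [hP])
  have hP0 : span {2 * b 1 - 1} ≠ ⊥ := by
    intro h
    rw [h, absNorm_bot] at hP
    exact hpp.ne_zero hP.symm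
  have := card_absNorm_eq_pow_of_unique hpp one_pos (P := span {2 * b 1 - 1})
    (by rw [hP, pow_one]) (by
      intro M hM hpM
      refine ((hPp.isMaximal hP0).eq_of_le hM.ne_top
        ((span_singleton_le_iff_mem _).mpr ?_)).symm
      refine hM.isPrime.mem_of_pow_mem 2 ?_
      rw [hsq]
      exact neg_mem hpM) k
  simpa using this

omit [NumberField K] in
theorem not_mem_span_natCast (ℓ : ℕ) (hℓ : ℓ.Prime) (b : Module.Basis (Fin 2) ℤ (𝓞 K))
    (h0 : b 0 = 1) (a : ℤ) : b 1 - a ∉ span {(ℓ : 𝓞 K)} := by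
  intro h
  obtain ⟨z, hz⟩ := mem_span_singleton'.mp h
  have h2 := congrArg (fun x => b.repr x 1) hz
  have h3 : b 1 - a = b 1 - a • b 0 := by rw [h0]; simp
  have h4 : z * ℓ = (ℓ : ℤ) • z := by simp [mul_comm]
  simp only [h3, h4, map_smul, map_sub, Module.Basis.repr_self, Finsupp.smul_apply,
    Finsupp.sub_apply, smul_eq_mul] at h2
  simp at h2
  exact (Nat.prime_iff_prime_int.mp hℓ).not_isUnit (isUnit_of_dvd_one ⟨_, h2.symm⟩)

theorem span_pair_mul_span_pair_eq (n ℓ : ℕ) (hℓ : ℓ.Prime) {θ : 𝓞 K}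
    (h1 : θ ^ 2 = θ - (n + 1)) (a : ℤ) (ha : (ℓ : ℤ) ∣ a ^ 2 - a + (n + 1))
    (ha2 : ¬ (ℓ : ℤ) ∣ 2 * a - 1) :
    span {(ℓ : 𝓞 K), θ - a} * span {(ℓ : 𝓞 K), θ - (1 - a : ℤ)} = span {(ℓ : 𝓞 K)} := by
  have hℓ' : Prime (ℓ : ℤ) := Nat.prime_iff_prime_int.mp hℓ
  obtain ⟨c, hc⟩ := ha
  have hc' : (a : 𝓞 K) ^ 2 - a + (n + 1) = ℓ * c := by
    exact_mod_cast congrArg (Int.cast (R := 𝓞 K)) hc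
  rw [span_pair_mul_span_pair]
  apply le_antisymm
  · rw [span_le]
    rintro x (rfl | rfl | rfl | rfl)
    all_goals rw [SetLike.mem_coe, mem_span_singleton]
    · exact dvd_mul_right _ _
    · exact dvd_mul_right _ _
    · exact dvd_mul_left _ _
    · refine ⟨-c, ?_⟩
      push_cast
      linear_combination h1 - hc'
  · rw [span_singleton_le_iff_mem]
    obtain ⟨u, v, huv⟩ := hℓ'.coprime_iff_not_dvd.mpr ha2
    have huv' : (u : 𝓞 K) * ℓ + v * (2 * a - 1) = 1 := by
      exact_mod_cast congrArg (Int.cast (R := 𝓞 K)) huv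
    have e : (ℓ : 𝓞 K) = u * (ℓ * ℓ) + (v * (ℓ * (θ - (1 - a : ℤ))) + -v * ((θ - a) * ℓ)) := by
      push_cast
      linear_combination -(ℓ : 𝓞 K) * huv'
    set S : Set (𝓞 K) := {(ℓ : 𝓞 K) * ℓ, (ℓ : 𝓞 K) * (θ - (1 - a : ℤ)), (θ - a) * ℓ,
      (θ - a) * (θ - (1 - a : ℤ))} with hS
    rw [e]
    refine add_mem ?_ (add_mem ?_ ?_) <;>
      exact Ideal.mul_mem_left _ _ (subset_span (by simp [hS]))

theorem card_absNorm_eq_pow_split (n ℓ : ℕ) [Fact ℓ.Prime]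
    (b : Module.Basis (Fin 2) ℤ (𝓞 K)) (h0 : b 0 = 1) (h1 : (b 1) ^ 2 = b 1 - (n + 1))
    (a : ℤ) (ha : (ℓ : ℤ) ∣ a ^ 2 - a + (n + 1)) (ha2 : ¬ (ℓ : ℤ) ∣ 2 * a - 1) (k : ℕ) :
    Nat.card {I : Ideal (𝓞 K) // absNorm I = ℓ ^ k} = k + 1 := by
  have hℓ : ℓ.Prime := Fact.out
  have hℓ' : Prime (ℓ : ℤ) := Nat.prime_iff_prime_int.mp hℓ
  have hmul := span_pair_mul_span_pair_eq n ℓ hℓ h1 a ha ha2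
  set P := span {(ℓ : 𝓞 K), b 1 - a} with hPdef
  set Q := span {(ℓ : 𝓞 K), b 1 - (1 - a : ℤ)} with hQdef
  have hPm : b 1 - a ∈ P := subset_span (by simp)
  have hQm : b 1 - (1 - a : ℤ) ∈ Q := subset_span (by simp)
  have hPℓ : (ℓ : 𝓞 K) ∈ P := subset_span (by simp)
  have hN : absNorm P * absNorm Q = ℓ ^ 2 := by
    rw [← map_mul, hmul, absNorm_span_natCast, finrank_of_basis b]
  have hP1 : absNorm P ≠ 1 := by
    rw [Ne, absNorm_eq_one_iff]
    intro htop
    rw [htop, top_mul] at hmul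
    rw [hmul] at hQm
    exact not_mem_span_natCast ℓ hℓ b h0 _ hQm
  have hQ1 : absNorm Q ≠ 1 := by
    rw [Ne, absNorm_eq_one_iff]
    intro htop
    rw [htop, mul_top] at hmul
    rw [hmul] at hPm
    exact not_mem_span_natCast ℓ hℓ b h0 _ hPm
  obtain ⟨hP, hQ⟩ := (Nat.Prime.mul_eq_prime_sq_iff hℓ hP1 hQ1).mp hN
  refine card_absNorm_eq_pow_of_pair hℓ hP hQ ?_ ?_ k
  · intro hPQ
    rw [← hPQ] at hQm
    refine hP1 (absNorm_eq_one_iff.mpr ((eq_top_iff_one _).mpr ?_))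
    obtain ⟨u, v, huv⟩ := hℓ'.coprime_iff_not_dvd.mpr ha2
    have huv' : (u : 𝓞 K) * ℓ + v * (2 * a - 1) = 1 := by
      exact_mod_cast congrArg (Int.cast (R := 𝓞 K)) huv
    have e : (1 : 𝓞 K) = u * ℓ + (v * (b 1 - (1 - a : ℤ)) + -v * (b 1 - a)) := by
      push_cast
      linear_combination -huv'
    rw [e]
    exact add_mem (P.mul_mem_left _ hPℓ) (add_mem (P.mul_mem_left _ hQm) (P.mul_mem_left _ hPm))
  · intro M hM hℓM
    have hle : P * Q ≤ M := by rw [hmul]; exact (span_singleton_le_iff_mem _).mpr hℓM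
    have hmax : ∀ I : Ideal (𝓞 K), absNorm I = ℓ → I.IsMaximal := by
      intro I hI
      refine (isPrime_of_irreducible_absNorm (by rwa [hI])).isMaximal ?_
      rintro rfl
      rw [absNorm_bot] at hI
      exact hℓ.ne_zero hI.symm
    rcases hM.isPrime.mul_le.mp hle with h | h
    · exact Or.inl ((hmax P hP).eq_of_le hM.ne_top h).symm
    · exact Or.inr ((hmax Q hQ).eq_of_le hM.ne_top h).symm

end PrimeDecomposition

section DedekindZeta

open NumberField Ideal Filter Topology ArithmeticFunction
open scoped ArithmeticFunction.zeta

variable {K : Type*} [Field K] [NumberField K]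

/-- The quadratic character modulo `p` as an arithmetic function. -/
noncomputable def quadraticCharArith (p : ℕ) [Fact p.Prime] : ArithmeticFunction ℤ :=
  ⟨fun k => quadraticChar (ZMod p) k, by simp⟩

theorem quadraticCharArith_apply (p : ℕ) [Fact p.Prime] (k : ℕ) :
    quadraticCharArith p k = quadraticChar (ZMod p) k := rfl

theorem isMultiplicative_quadraticCharArith (p : ℕ) [Fact p.Prime] :
    (quadraticCharArith p).IsMultiplicative :=
  ⟨by simp [quadraticCharArith_apply], fun _ => by
    simp only [quadraticCharArith_apply, Nat.cast_mul, map_mul]⟩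

variable (K) in
/-- The number of ideals of norm `n ≠ 0`, as an arithmetic function. -/
noncomputable def idealCount : ArithmeticFunction ℤ :=
  ⟨fun n => if n = 0 then 0 else Nat.card {I : Ideal (𝓞 K) // absNorm I = n}, by simp⟩

theorem idealCount_apply {n : ℕ} (hn : n ≠ 0) :
    idealCount K n = Nat.card {I : Ideal (𝓞 K) // absNorm I = n} := if_neg hn

theorem isMultiplicative_idealCount : (idealCount K).IsMultiplicative := by
  rw [IsMultiplicative.iff_ne_zero]
  refine ⟨?_, fun {m n} hm hn h => ?_⟩
  · rw [idealCount_apply one_ne_zero]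
    simp [absNorm_eq_one_iff]
  · rw [idealCount_apply hm, idealCount_apply hn, idealCount_apply (mul_ne_zero hm hn),
      card_absNorm_mul_of_coprime hm hn h, Nat.cast_mul]

theorem zeta_mul_quadraticCharArith_prime_pow (p ℓ k : ℕ) [Fact p.Prime] (hℓ : ℓ.Prime) :
    ((ζ : ArithmeticFunction ℤ) * quadraticCharArith p) (ℓ ^ k) =
      ∑ j ∈ Finset.range (k + 1), quadraticChar (ZMod p) ℓ ^ j := by
  rw [coe_zeta_mul_apply, Nat.sum_divisors_prime_pow hℓ]
  simp only [quadraticCharArith_apply, Nat.cast_pow, map_pow]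

theorem idealCount_eq (p n : ℕ) [Fact p.Prime] (hp : p = 4 * n + 3)
    (b : Module.Basis (Fin 2) ℤ (𝓞 K)) (h0 : b 0 = 1) (h1 : (b 1) ^ 2 = b 1 - (n + 1)) :
    idealCount K = (ζ : ArithmeticFunction ℤ) * quadraticCharArith p := by
  rw [isMultiplicative_idealCount.eq_iff_eq_on_prime_powers _ _
    (isMultiplicative_zeta.natCast.mul (isMultiplicative_quadraticCharArith p))]
  intro ℓ k hℓ
  have : Fact ℓ.Prime := ⟨hℓ⟩
  rw [zeta_mul_quadraticCharArith_prime_pow p ℓ k hℓ, idealCount_apply (pow_ne_zero _ hℓ.ne_zero)]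
  by_cases hz : (ℓ : ZMod p) = 0
  · have hℓp : ℓ = p := ((Nat.prime_dvd_prime_iff_eq Fact.out hℓ).mp
      ((ZMod.natCast_eq_zero_iff ℓ p).mp hz)).symm
    subst hℓp
    rw [card_absNorm_eq_pow_ramified ℓ n hp b h1 k, Finset.sum_range_succ']
    simp
  · rcases quadraticChar_dichotomy hz with h | h
    · obtain ⟨a, ha, ha2⟩ := exists_root_of_quadraticChar_eq_one p n ℓ hp h
      rw [card_absNorm_eq_pow_split n ℓ b h0 h1 a ha ha2 k, h]
      simp
    · rw [card_absNorm_eq_pow_inert n ℓ b h0 h1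
        (not_dvd_of_quadraticChar_eq_neg_one p n ℓ hp h) k, h, neg_one_geom_sum]
      by_cases hk : 2 ∣ k
      · rw [if_pos hk, if_neg (by rw [Nat.even_add_one, not_not]; exact even_iff_two_dvd.mpr hk)]
        rfl
      · rw [if_neg hk, if_pos (by rw [Nat.even_add_one, even_iff_two_dvd]; exact hk)]
        rfl

/-- The Dedekind zeta function of `ℚ(√-p)` factors as `ζ(s) L(s, χ)`. -/
theorem dedekindZeta_eq_mul (p n : ℕ) [Fact p.Prime] (hp : p = 4 * n + 3)
    (b : Module.Basis (Fin 2) ℤ (𝓞 K)) (h0 : b 0 = 1) (h1 : (b 1) ^ 2 = b 1 - (n + 1))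
    {s : ℂ} (hs : 1 < s.re) :
    dedekindZeta K s =
      riemannZeta s * LSeries (fun k : ℕ => ((quadraticChar (ZMod p) k : ℤ) : ℂ)) s := by
  have hχ : LSeriesSummable (fun k : ℕ => ((quadraticChar (ZMod p) k : ℤ) : ℂ)) s :=
    ZMod.LSeriesSummable_of_one_lt_re (fun x : ZMod p => ((quadraticChar (ZMod p) x : ℤ) : ℂ)) hs
  rw [← LSeries_zeta_eq_riemannZeta hs,
    ← LSeries_convolution' (LSeriesSummable_zeta_iff.mpr hs) hχ]
  refine LSeries_congr (fun {m} hm => ?_) s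
  have h := congrArg (fun f => ((f m : ℤ) : ℂ)) (idealCount_eq p n hp b h0 h1)
  simp only [idealCount_apply hm, ArithmeticFunction.mul_apply] at h
  rw [LSeries.convolution_def]
  push_cast at h
  simp only [quadraticCharArith_apply] at h
  rw [h]
  simp

/-- Dirichlet's class number formula for `ℚ(√-p)`, `p ≡ 3 (mod 4)`, `p > 3`. -/
theorem classNumber_mul_eq (p n : ℕ) [Fact p.Prime] (hp : p = 4 * n + 3) (hn : 0 < n)
    (b : Module.Basis (Fin 2) ℤ (𝓞 K)) (h0 : b 0 = 1) (h1 : (b 1) ^ 2 = b 1 - (n + 1)) :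
    (classNumber K : ℤ) * p = -∑ a : ZMod p, quadraticChar (ZMod p) a * a.val := by
  have hpp : p.Prime := Fact.out
  have hlim1 := tendsto_sub_one_mul_dedekindZeta_nhdsGT K
  have hζ : Tendsto (fun s : ℝ => ((s : ℂ) - 1) * riemannZeta s) (𝓝[>] 1) (𝓝 1) := by
    refine riemannZeta_residue_one.comp ?_
    rw [tendsto_nhdsWithin_iff]
    constructor
    · exact (Complex.continuous_ofReal.tendsto' 1 1 (by simp)).mono_left nhdsWithin_le_nhds
    · filter_upwards [self_mem_nhdsWithin] with s hs
      simpa using (ne_of_gt hs)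
  have hlim2 := hζ.mul (tendsto_LSeries_quadraticChar p n hp)
  have heq : (fun s : ℝ => ((s : ℂ) - 1) * dedekindZeta K s) =ᶠ[𝓝[>] 1]
      fun s : ℝ => ((s : ℂ) - 1) * riemannZeta s *
        LSeries (fun k : ℕ => ((quadraticChar (ZMod p) k : ℤ) : ℂ)) s := by
    filter_upwards [self_mem_nhdsWithin] with s hs
    rw [dedekindZeta_eq_mul p n hp b h0 h1 (by simpa using hs), mul_assoc]
  have huniq := tendsto_nhds_unique (hlim1.congr' heq) hlim2
  rw [dedekindZeta_residue_of_basis p n hp hn b h0 h1, one_mul] at huniq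
  have hR : Real.pi * classNumber K / Real.sqrt p = -(Real.pi / (p * Real.sqrt p) *
      ∑ a : ZMod p, (quadraticChar (ZMod p) a : ℝ) * a.val) := by
    apply Complex.ofReal_injective
    rw [huniq]
    push_cast
    rfl
  have hp0 : (p : ℝ) ≠ 0 := by exact_mod_cast hpp.ne_zero
  have hs0 : Real.sqrt p ≠ 0 := Real.sqrt_ne_zero'.mpr (by exact_mod_cast hpp.pos)
  have hfin : (classNumber K : ℝ) * p =
      -∑ a : ZMod p, (quadraticChar (ZMod p) a : ℝ) * a.val := by
    have hpi := Real.pi_ne_zero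
    field_simp at hR
    linear_combination hR
  exact_mod_cast hfin

end DedekindZeta

/-- For a prime `p ≡ 3 (mod 4)`, `p > 3`, and `h` the class number of
`ℚ(√-p)`, one has `-∏_{k=0}^{(p-3)/2} (2k+1) ≡ (-1)^{(p+1)/4 + (h+1)/2} (mod p)`. -/
theorem neg_prod_odd_numbers_mod_p (p : ℕ) [Fact p.Prime] (hp : p % 4 = 3) (hp3 : 3 < p)
    (K : Type*) [Field K] [NumberField K] (α : K) (hα : α ^ 2 = -(p : K))
    (hK : ∀ x : K, ∃ a b : ℚ, x = (a : K) + (b : K) * α) :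
    ((-(∏ k ∈ Finset.range ((p - 1) / 2), (2 * (k : ℤ) + 1)) : ℤ) : ZMod p)
      = (-1 : ZMod p) ^ ((p + 1) / 4 + (NumberField.classNumber K + 1) / 2) := by
  obtain ⟨n, hn⟩ : ∃ n, p = 4 * n + 3 := ⟨p / 4, by omega⟩
  obtain ⟨b, h0, h1⟩ := exists_basis_ringOfIntegers p n hn K α hα hK
  have h := neg_prod_odd_eq_of_sum_quadraticChar p n _ hn
    (classNumber_mul_eq p n hn (by omega) b h0 h1)
  rw [show (p - 1) / 2 = 2 * n + 1 by omega, show (p + 1) / 4 = n + 1 by omega, ← h]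
  push_cast
  rfl
end

section
/- Let p ≡ 3 (mod 4) be a prime, p > 3. Define the matrix T over F_p by T = [(s_i+s_j)^{p-3} + (s_i-s_j)^{p-3}]_{1≤i,j≤(p-1)/2}, where s_1, ..., s_{(p-1)/2} are the nonzero squares in F_p (this corresponds to r = 2). Then det(T) = (-1)^{(p+1)/4} in F_p. -/
open Finset in
theorem Finset.sum_range_two_mul_add_one_of_odd_eq_zero {M : Type*} [AddCommMonoid M] (g : ℕ → M)
    (hg : ∀ k, Odd k → g k = 0) (m : ℕ) :
    ∑ k ∈ range (2 * m + 1), g k = ∑ l ∈ range (m + 1), g (2 * l) := by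
  induction m with
  | zero => simp
  | succ m ih =>
    rw [show 2 * (m + 1) + 1 = 2 * m + 1 + 1 + 1 by ring, sum_range_succ, sum_range_succ, ih,
      sum_range_succ _ (m + 1), hg (2 * m + 1) ⟨m, rfl⟩, add_zero]
    rfl

open Finset in
/-- The even part of the binomial expansion. -/
theorem add_pow_add_sub_pow_two_mul {R : Type*} [CommRing R] (x y : R) (m : ℕ) :
    (x + y) ^ (2 * m) + (x - y) ^ (2 * m) =
      ∑ l ∈ range (m + 1), x ^ (2 * l) * (2 * ((2 * m).choose (2 * l) : R)) *
        y ^ (2 * (m - l)) := by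
  have h : (x - y) ^ (2 * m) = (-x + y) ^ (2 * m) := by
    rw [← Even.neg_pow ⟨m, two_mul m⟩ (x - y), neg_sub, sub_eq_neg_add]
  rw [h, add_pow, add_pow, ← sum_add_distrib, sum_range_two_mul_add_one_of_odd_eq_zero]
  · refine sum_congr rfl fun l _ => ?_
    rw [Even.neg_pow ⟨l, two_mul l⟩, Nat.mul_sub]
    ring
  · intro k hk
    rw [hk.neg_pow]
    ring

open Finset in
theorem Nat.prod_range_two_mul_add_one_mul_eq_factorial (n : ℕ) :
    ∏ l ∈ range n, (2 * l + 1) * (2 * l + 2) = (2 * n).factorial := by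
  induction n with
  | zero => simp
  | succ n ih =>
    rw [prod_range_succ, ih, show 2 * (n + 1) = 2 * n + 1 + 1 by ring, Nat.factorial_succ,
      Nat.factorial_succ]
    ring

theorem ZMod.two_mul_choose_sub_three {p : ℕ} [Fact p.Prime] {k : ℕ} (hk : k + 3 ≤ p) :
    2 * ((p - 3).choose k : ZMod p) = (-1) ^ k * ((k + 1) * (k + 2)) := by
  induction k with
  | zero => simp
  | succ k ih =>
    have hne : ((k + 1 : ℕ) : ZMod p) ≠ 0 := by
      rw [Ne, ZMod.natCast_eq_zero_iff]
      exact Nat.not_dvd_of_pos_of_lt k.succ_pos (by omega)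
    have h := congrArg (Nat.cast : ℕ → ZMod p) (Nat.choose_succ_right_eq (p - 3) k)
    rw [Nat.cast_mul, Nat.cast_mul, Nat.cast_sub (by omega), Nat.cast_sub (by omega),
      ZMod.natCast_self] at h
    apply mul_right_cancel₀ hne
    rw [mul_assoc, h, ← mul_assoc, ih (by omega)]
    push_cast
    ring

/-- A Vandermonde matrix times its inverse-transpose companion, at `n` distinct `n`-th roots of
unity. -/
theorem Matrix.of_pow_mul_of_inv_pow {K : Type*} [Field K] {n : ℕ} (u : Fin n → K)
    (hu : Function.Injective u) (hun : ∀ i, u i ^ n = 1) (hu0 : ∀ i, u i ≠ 0) :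
    (Matrix.of fun i l : Fin n => u i ^ (l : ℕ)) *
      (Matrix.of fun l j : Fin n => (u j)⁻¹ ^ (l : ℕ)) = Matrix.diagonal fun _ => (n : K) := by
  ext i j
  simp only [Matrix.mul_apply, Matrix.of_apply, ← mul_pow]
  rw [Fin.sum_univ_eq_sum_range fun l => (u i * (u j)⁻¹) ^ l]
  rcases eq_or_ne i j with rfl | hij
  · simp [hu0]
  · rw [Matrix.diagonal_apply_ne _ hij]
    have h1 : u i * (u j)⁻¹ - 1 ≠ 0 := by
      rw [sub_ne_zero, Ne, mul_inv_eq_one₀ (hu0 j)]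
      exact fun h => hij (hu h)
    apply mul_right_cancel₀ h1
    rw [geom_sum_mul, mul_pow, inv_pow, hun, hun]
    simp

theorem ZMod.two_pow_half_of_mod_four_eq_three {p : ℕ} [Fact p.Prime] (hp : p % 4 = 3) :
    (2 : ZMod p) ^ ((p - 1) / 2) = (-1) ^ ((p + 1) / 4) := by
  have hp2 : p ≠ 2 := by omega
  have h := legendreSym.eq_pow p 2
  rw [legendreSym.at_two hp2, ZMod.χ₈_nat_eq_if_mod_eight,
    show p / 2 = (p - 1) / 2 by omega] at h
  push_cast at h
  rw [← h]
  rcases (by omega : p % 8 = 3 ∨ p % 8 = 7) with h8 | h8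
  · rw [Odd.neg_one_pow (by rw [Nat.odd_iff]; omega)]
    simp [h8, show p % 2 = 1 by omega]
  · rw [Even.neg_one_pow (by rw [Nat.even_iff]; omega)]
    simp [h8, show p % 2 = 1 by omega]

theorem Finset.prod_sq_eq_one_of_inv_mem_range {ι K : Type*} [Fintype ι] [Field K] (s : ι → K)
    (hs : Function.Injective s) (hs0 : ∀ i, s i ≠ 0) (hinv : ∀ i, ∃ j, s j = (s i)⁻¹) :
    ∏ i, s i ^ 2 = 1 := by
  choose σ hσ using hinv
  have hσi : Function.Injective σ := fun i j h => hs (inv_injective (by rw [← hσ, ← hσ, h]))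
  have h := (Finite.injective_iff_bijective.mp hσi).prod_comp s
  simp only [sq]
  rw [Finset.prod_mul_distrib]
  nth_rewrite 1 [← h]
  rw [← Finset.prod_mul_distrib]
  exact Finset.prod_eq_one fun i _ => by rw [hσ, inv_mul_cancel₀ (hs0 i)]

/-- For a prime `p ≡ 3 (mod 4)`, `p > 3`, and `s_1,…,s_{(p-1)/2}` the nonzero
squares in `F_p`, the matrix `T = [(s_i+s_j)^{p-3} + (s_i-s_j)^{p-3}]` satisfies
`det T = (-1)^{(p+1)/4}` in `F_p`. -/
theorem det_T_p_2_r_eq_two (p : ℕ) [Fact p.Prime] (hp : p % 4 = 3) (hp3 : 3 < p)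
    (s : Fin ((p - 1) / 2) → ZMod p) (hs : Function.Injective s)
    (hsimg : ∀ x : ZMod p, (∃ i, s i = x) ↔ ∃ y : ZMod p, y ≠ 0 ∧ y ^ 2 = x) :
    (Matrix.of fun i j => (s i + s j) ^ (p - 3) + (s i - s j) ^ (p - 3)).det
      = (-1 : ZMod p) ^ ((p + 1) / 4) := by
  have h2pow := ZMod.two_pow_half_of_mod_four_eq_three hp
  generalize hn : (p - 1) / 2 = n at s hs hsimg h2pow ⊢
  have hp1 : p - 1 = 2 * n := by omega
  have hodd : Odd n := by rw [Nat.odd_iff]; omega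
  have hne : (-1 : ZMod p) ≠ 1 :=
    haveI : Fact (2 < p) := ⟨by omega⟩
    ZMod.neg_one_ne_one
  have hsq (i) : ∃ y : ZMod p, y ≠ 0 ∧ y ^ 2 = s i := (hsimg (s i)).mp ⟨i, rfl⟩
  have hs0 (i) : s i ≠ 0 := by
    obtain ⟨y, hy, h⟩ := hsq i
    exact h ▸ pow_ne_zero 2 hy
  have hsn (i) : s i ^ n = 1 := by
    obtain ⟨y, hy, h⟩ := hsq i
    rw [← h, ← pow_mul, ← hp1, ZMod.pow_card_sub_one_eq_one hy]
  have hun (i) : (s i ^ 2) ^ n = 1 := by rw [pow_right_comm, hsn, one_pow]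
  have hu0 (i) : s i ^ 2 ≠ 0 := pow_ne_zero 2 (hs0 i)
  have hu : Function.Injective fun i => s i ^ 2 := by
    intro i j hij
    rcases sq_eq_sq_iff_eq_or_eq_neg.mp hij with h | h
    · exact hs h
    · have hi := hsn i
      rw [h, hodd.neg_pow, hsn] at hi
      exact absurd hi hne
  have hprod : ∏ i, s i ^ 2 = 1 := by
    refine Finset.prod_sq_eq_one_of_inv_mem_range s hs hs0 fun i => (hsimg _).mpr ?_
    obtain ⟨y, hy, h⟩ := hsq i
    exact ⟨y⁻¹, inv_ne_zero hy, by rw [inv_pow, h]⟩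
  have hfact : (Matrix.of fun i j => (s i + s j) ^ (p - 3) + (s i - s j) ^ (p - 3)) =
      (Matrix.of fun i l : Fin n => (s i ^ 2) ^ (l : ℕ)) *
        Matrix.diagonal (fun l : Fin n => (((2 * l + 1) * (2 * l + 2) : ℕ) : ZMod p)) *
        (Matrix.of fun l j : Fin n => (s j ^ 2)⁻¹ ^ (l : ℕ)) *
        Matrix.diagonal (fun j => (s j ^ 2)⁻¹) := by
    ext i j
    rw [Matrix.mul_diagonal, Matrix.mul_apply]
    simp only [Matrix.mul_diagonal, Matrix.of_apply]
    have hm : p - 3 = 2 * (n - 1) := by omega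
    rw [hm, add_pow_add_sub_pow_two_mul, ← hm, Nat.sub_add_cancel hodd.pos, Finset.sum_mul,
      ← Fin.sum_univ_eq_sum_range
        fun l => s i ^ (2 * l) * (2 * ((p - 3).choose (2 * l) : ZMod p)) * s j ^ (2 * (n - 1 - l))]
    refine Finset.sum_congr rfl fun l _ => ?_
    have hl := l.isLt
    have hpow : s j ^ (2 * (n - 1 - l)) = (s j ^ 2)⁻¹ ^ (l : ℕ) * (s j ^ 2)⁻¹ := by
      rw [← pow_succ, inv_pow, ← mul_eq_one_iff_eq_inv₀ (pow_ne_zero _ (hu0 j)), pow_mul,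
        ← pow_add, show n - 1 - l + (l + 1) = n by omega, hun]
    rw [ZMod.two_mul_choose_sub_three (by omega), hpow, Even.neg_one_pow ⟨l, two_mul _⟩]
    push_cast
    ring
  have hVV : (Matrix.of fun i l : Fin n => (s i ^ 2) ^ (l : ℕ)).det *
      (Matrix.of fun l j : Fin n => (s j ^ 2)⁻¹ ^ (l : ℕ)).det = (n : ZMod p) ^ n := by
    rw [← Matrix.det_mul, Matrix.of_pow_mul_of_inv_pow _ hu hun hu0, Matrix.det_diagonal]
    simp
  have hwilson : ∏ l : Fin n, (((2 * l + 1) * (2 * l + 2) : ℕ) : ZMod p) = -1 := by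
    rw [Fin.prod_univ_eq_prod_range fun l => (((2 * l + 1) * (2 * l + 2) : ℕ) : ZMod p),
      ← Nat.cast_prod, Nat.prod_range_two_mul_add_one_mul_eq_factorial, ← hp1,
      ZMod.wilsons_lemma]
  have hinv : (2 : ZMod p) * n = -1 := by
    rw [← Nat.cast_ofNat, ← Nat.cast_mul, ← hp1, Nat.cast_sub (by omega), ZMod.natCast_self]
    simp
  have hnn : (-1 : ZMod p) ^ ((p + 1) / 4) * (n : ZMod p) ^ n = -1 := by
    rw [← h2pow, ← mul_pow, hinv, hodd.neg_one_pow]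
  have hε : (-1 : ZMod p) ^ ((p + 1) / 4) * (-1 : ZMod p) ^ ((p + 1) / 4) = 1 := by
    rw [← mul_pow, neg_one_mul, neg_neg, one_pow]
  rw [hfact, Matrix.det_mul, Matrix.det_mul, Matrix.det_mul, Matrix.det_diagonal,
    Matrix.det_diagonal, hwilson, Finset.prod_inv_distrib, hprod]
  linear_combination (-1 : ZMod p) * hVV + (n : ZMod p) ^ n * hε
    - (-1 : ZMod p) ^ ((p + 1) / 4) * hnn
end
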